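/- arXiv:gr-qc/0002034 — 2 statements merged into one kernel-verified Lean document; each statement's English description precedes it below -/
import Mathlib

section
/- Let (f, A, C) be an a-orbit of the mini-boson-star system with parameters a > 0, α > 1, defined for all x ≥ 0, with (f(x), f'(x)) ≠ (0, 0) for all x, whose rotation function θ is bounded above. Then the function g = 1 − A C² is eventually positive: there exists x₁ such that g(x) > 0 for all x > x₁. -/
open Real Set Filter Topology MeasureTheory

noncomputable section

/-- The mini-boson-star ODE system for `f, A, C` on a set `s ⊆ (0, ∞)`
(prime denotes `d/dx`):
`(x² f'/C)' = (x²/(A C))·(1 − A C²)·f`,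
`A' = (1 − A)/x − x·(A f'² + A C² f² + f²)`,
`C' = (C/(x A))·(A − 1 + x² f²)`, with `A > 0` and `C > 0`. -/
def MiniBosonSystem (f A C : ℝ → ℝ) (s : Set ℝ) : Prop :=
  ∀ x ∈ s, 0 < x ∧ 0 < A x ∧ 0 < C x ∧
    DifferentiableAt ℝ f x ∧ DifferentiableAt ℝ (deriv f) x ∧
    DifferentiableAt ℝ A x ∧ DifferentiableAt ℝ C x ∧
    deriv (fun y => y ^ 2 * deriv f y / C y) x
      = x ^ 2 / (A x * C x) * (1 - A x * C x ^ 2) * f x ∧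
    deriv A x = (1 - A x) / x
      - x * (A x * deriv f x ^ 2 + A x * C x ^ 2 * f x ^ 2 + f x ^ 2) ∧
    deriv C x = C x / (x * A x) * (A x - 1 + x ^ 2 * f x ^ 2)

/-- A domain of the form `[0, x̄)` with `0 < x̄ ≤ ∞`. -/
def IsOrbitDomain (s : Set ℝ) : Prop :=
  s = Set.Ici (0 : ℝ) ∨ ∃ xbar > (0 : ℝ), s = Set.Ico 0 xbar

/-- An `a`-orbit of the mini-boson-star system with parameters `a, α` on the
domain `s = [0, x̄)`: a solution of the system on `s \ {0}`, continuous up to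
`x = 0` with `f` differentiable at `0`, satisfying `f 0 = a`, `f' 0 = 0`,
`A 0 = 1`, `C 0 = α`. -/
def IsAOrbit (f A C : ℝ → ℝ) (a α : ℝ) (s : Set ℝ) : Prop :=
  IsOrbitDomain s ∧
  MiniBosonSystem f A C (s \ {0}) ∧
  ContinuousWithinAt f s 0 ∧ ContinuousWithinAt A s 0 ∧ ContinuousWithinAt C s 0 ∧
  HasDerivWithinAt f 0 s 0 ∧
  f 0 = a ∧ A 0 = 1 ∧ C 0 = α

/-- The mass function `M(x) = x (1 − A x)/2`. -/
def massFn (A : ℝ → ℝ) (x : ℝ) : ℝ := x * (1 - A x) / 2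

/-- `θ` is the rotation function of the orbit with scalar field `f`:
`θ` is continuous on the domain, `θ 0 = 0`, and for every `x` in the domain
there is `ρ x > 0` with `f x = ρ x · cos (θ x)` and `f' x = −ρ x · sin (θ x)`. -/
def IsRotation (f θ : ℝ → ℝ) (s : Set ℝ) : Prop :=
  ContinuousOn θ s ∧ θ 0 = 0 ∧
  ∀ x ∈ s, ∃ ρ > (0 : ℝ), f x = ρ * Real.cos (θ x) ∧ deriv f x = -(ρ * Real.sin (θ x))

/-- A continuous function that is negative just to the left of each of its zeros stays positive
once it is positive. -/
theorem pos_of_neg_left_of_zeros {h : ℝ → ℝ} (hc : ContinuousOn h (Ioi 0))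
    (hz : ∀ y, 0 < y → h y = 0 → ∀ᶠ x in 𝓝[<] y, h x < 0)
    {x₀ : ℝ} (hx₀ : 0 < x₀) (hpos : 0 < h x₀) {x : ℝ} (hx : x₀ ≤ x) : 0 < h x := by
  by_contra hneg
  have hc' : ContinuousOn h (Icc x₀ x) := hc.mono fun z hz => hx₀.trans_le hz.1
  have hcomp : IsCompact (Icc x₀ x ∩ h ⁻¹' Iic 0) :=
    isCompact_Icc.of_isClosed_subset (hc'.preimage_isClosed_of_isClosed isClosed_Icc isClosed_Iic)
      inter_subset_left
  obtain ⟨y, ⟨hyI, hy0⟩, hmin⟩ := hcomp.exists_isLeast ⟨x, ⟨hx, le_rfl⟩, not_lt.1 hneg⟩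
  have hxy : x₀ < y := lt_of_le_of_ne hyI.1 (by rintro rfl; exact absurd hy0 (not_le.2 hpos))
  have hleft : ∀ᶠ z in 𝓝[<] y, 0 < h z := by
    filter_upwards [Ioo_mem_nhdsLT hxy] with z hz
    by_contra hzn
    exact absurd (hmin ⟨⟨hz.1.le, hz.2.le.trans hyI.2⟩, not_lt.1 hzn⟩) (not_le.2 hz.2)
  have hcont : ContinuousAt h y := hc.continuousAt (Ioi_mem_nhds (hx₀.trans hxy))
  have hy : h y = 0 := le_antisymm hy0 <|
    ge_of_tendsto (hcont.mono_left nhdsWithin_le_nhds) (hleft.mono fun _ => le_of_lt)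
  obtain ⟨z, hz1, hz2⟩ := (hleft.and (hz y (hx₀.trans hxy) hy)).exists
  exact absurd hz1 hz2.not_gt

/-- A positive function `f` for which `x² f'/C` is nonincreasing, with `C ≥ 1`, decays no faster
than `1/x`. -/
theorem exists_le_mul_of_antitoneOn {f v C : ℝ → ℝ} {X : ℝ} (hX : 0 < X)
    (hf : ∀ x, X < x → HasDerivAt f (v x) x) (hpos : ∀ x, X < x → 0 < f x)
    (hC : ∀ x, X < x → 1 ≤ C x)
    (hanti : AntitoneOn (fun x => x ^ 2 * v x / C x) (Ioi X)) :
    ∃ c > 0, ∃ Y > X, ∀ x, Y ≤ x → c ≤ x * f x := by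
  by_cases hv : ∃ x₁, X < x₁ ∧ v x₁ < 0
  · obtain ⟨x₁, hx₁, hv₁⟩ := hv
    have hx₁0 : 0 < x₁ := hX.trans hx₁
    set w := -(x₁ ^ 2 * v x₁ / C x₁) with hw
    have hw0 : 0 < w := by
      have := hC x₁ hx₁
      rw [hw, neg_pos]
      exact div_neg_of_neg_of_pos (mul_neg_of_pos_of_neg (by positivity) hv₁) (by linarith)
    have hbound : ∀ x, x₁ ≤ x → v x + w / x ^ 2 ≤ 0 := by
      intro x hx
      have hx0 : 0 < x := hx₁0.trans_le hx
      have hCx := hC x (hx₁.trans_le hx)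
      have h1 : x ^ 2 * v x / C x ≤ -w := by
        have := hanti (mem_Ioi.2 hx₁) (mem_Ioi.2 (hx₁.trans_le hx)) hx
        simpa [hw] using this
      rw [div_le_iff₀ (by linarith)] at h1
      have h2 : x ^ 2 * v x + w ≤ 0 := by nlinarith
      have h3 : v x + w / x ^ 2 = (x ^ 2 * v x + w) / x ^ 2 := by field_simp
      rw [h3]
      exact div_nonpos_of_nonpos_of_nonneg h2 (by positivity)
    have hder : ∀ x, x₁ ≤ x → HasDerivAt (fun x => f x - w * x⁻¹) (v x + w / x ^ 2) x := by
      intro x hx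
      have hx0 : 0 < x := hx₁0.trans_le hx
      refine ((hf x (hx₁.trans_le hx)).sub ((hasDerivAt_inv hx0.ne').const_mul w)).congr_deriv ?_
      field_simp
      ring
    have hmono : AntitoneOn (fun x => f x - w * x⁻¹) (Ici x₁) := by
      refine antitoneOn_of_hasDerivWithinAt_nonpos (f' := fun x => v x + w / x ^ 2) (convex_Ici x₁)
        (fun x hx => (hder x hx).continuousAt.continuousWithinAt) ?_ ?_
      · intro x hx
        rw [interior_Ici] at hx
        exact (hder x (le_of_lt hx)).hasDerivWithinAt
      · intro x hx
        rw [interior_Ici] at hx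
        exact hbound x (le_of_lt hx)
    refine ⟨w, hw0, x₁, hx₁, fun x hx => ?_⟩
    have hx0 : 0 < x := hx₁0.trans_le hx
    have hlim : Tendsto (fun y : ℝ => -(w * y⁻¹)) atTop (𝓝 0) := by
      simpa using (tendsto_inv_atTop_zero.const_mul w).neg
    have hge : 0 ≤ f x - w * x⁻¹ := by
      refine le_of_tendsto hlim ?_
      filter_upwards [eventually_ge_atTop x] with y hy
      have h1 := hmono (mem_Ici.2 hx) (mem_Ici.2 (hx.trans hy)) hy
      have h2 := hpos y (hx₁.trans_le (hx.trans hy))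
      simp only at h1
      linarith
    have h4 : x * (f x - w * x⁻¹) = x * f x - w := by field_simp
    have := mul_nonneg hx0.le hge
    linarith
  · push Not at hv
    have hX1 : X < X + 1 := by linarith
    have hmono : MonotoneOn f (Ici (X + 1)) := by
      refine monotoneOn_of_hasDerivWithinAt_nonneg (f' := v) (convex_Ici _)
        (fun x hx => (hf x (hX1.trans_le hx)).continuousAt.continuousWithinAt) ?_ ?_
      · intro x hx
        rw [interior_Ici] at hx
        exact (hf x (hX1.trans hx)).hasDerivWithinAt
      · intro x hx
        rw [interior_Ici] at hx
        exact hv x (hX1.trans hx)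
    have hp := hpos (X + 1) hX1
    refine ⟨(X + 1) * f (X + 1), by positivity, X + 1, hX1, fun x hx => ?_⟩
    have := hmono (mem_Ici.2 le_rfl) (mem_Ici.2 hx) hx
    have hx0 : 0 ≤ x := by linarith
    exact mul_le_mul hx this hp.le hx0

/-- Twice the mass function, `x (1 − A)`, has derivative `x² (A f'² + A C² f² + f²)`. -/
theorem MiniBosonSystem.hasDerivAt_mass {f A C : ℝ → ℝ} {s : Set ℝ} (h : MiniBosonSystem f A C s)
    {x : ℝ} (hx : x ∈ s) :
    HasDerivAt (fun y => y * (1 - A y))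
      (x ^ 2 * (A x * deriv f x ^ 2 + A x * C x ^ 2 * f x ^ 2 + f x ^ 2)) x := by
  obtain ⟨hx0, -, -, -, -, hdA, -, -, hA', -⟩ := h x hx
  refine ((hasDerivAt_id' x).mul (hdA.hasDerivAt.const_sub 1)).congr_deriv ?_
  rw [hA']
  field_simp
  ring

/-- The derivative of `A C²` along the mini-boson-star system. -/
theorem MiniBosonSystem.hasDerivAt_mul_sq {f A C : ℝ → ℝ} {s : Set ℝ}
    (h : MiniBosonSystem f A C s) {x : ℝ} (hx : x ∈ s) :
    HasDerivAt (fun y => A y * C y ^ 2)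
      (C x ^ 2 / x * (A x - 1 - x ^ 2 * A x * deriv f x ^ 2
        + x ^ 2 * f x ^ 2 * (1 - A x * C x ^ 2))) x := by
  obtain ⟨hx0, hA0, -, -, -, hdA, hdC, -, hA', hC'⟩ := h x hx
  refine (hdA.hasDerivAt.mul (hdC.hasDerivAt.pow 2)).congr_deriv ?_
  simp only [Pi.pow_apply]
  rw [hA', hC']
  push_cast
  field_simp
  ring

/-- Along an orbit that never vanishes to first order, `A < 1` away from the origin. -/
theorem MiniBosonSystem.lt_one {f A C : ℝ → ℝ} (h : MiniBosonSystem f A C (Ioi 0))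
    (hA : ContinuousWithinAt A (Ici 0) 0) (hnv : ∀ x, 0 < x → (f x, deriv f x) ≠ (0, 0))
    {x : ℝ} (hx : 0 < x) : A x < 1 := by
  have hmono : StrictMonoOn (fun y => y * (1 - A y)) (Ici 0) := by
    refine strictMonoOn_of_hasDerivWithinAt_pos
      (f' := fun x => x ^ 2 * (A x * deriv f x ^ 2 + A x * C x ^ 2 * f x ^ 2 + f x ^ 2))
      (convex_Ici 0) ?_ ?_ ?_
    · intro y hy
      rcases eq_or_lt_of_le (mem_Ici.1 hy) with rfl | hy
      · exact continuousWithinAt_id.mul (continuousWithinAt_const.sub hA)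
      · exact (h.hasDerivAt_mass hy).continuousAt.continuousWithinAt
    · intro y hy
      rw [interior_Ici] at hy
      exact (h.hasDerivAt_mass hy).hasDerivWithinAt
    · intro y hy
      rw [interior_Ici] at hy
      obtain ⟨hy0, hAy, hCy, -⟩ := h y hy
      by_cases hfy : f y = 0
      · have : deriv f y ≠ 0 := fun hd => hnv y hy (by rw [hfy, hd])
        positivity
      · positivity
  have := hmono (mem_Ici.2 le_rfl) (mem_Ici.2 hx.le) hx
  simp only [zero_mul] at this
  have := pos_of_mul_pos_right this hx.le
  linarith

/-- If `A C² ≥ 1` throughout, then `x² f²` cannot be eventually bounded below by a positive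
constant: `A C²` would decrease at least logarithmically. -/
theorem MiniBosonSystem.not_le_sq {f A C : ℝ → ℝ} (h : MiniBosonSystem f A C (Ioi 0))
    (hA1 : ∀ x, 0 < x → A x < 1) (hg : ∀ x, 0 < x → 1 ≤ A x * C x ^ 2)
    {c Y : ℝ} (hc : 0 < c) (hY : 0 < Y) : ¬ ∀ x, Y ≤ x → c ≤ x ^ 2 * f x ^ 2 := by
  intro hlow
  have hmass : MonotoneOn (fun x => x * (1 - A x) - c * x) (Ici Y) := by
    have hder : ∀ x, Y ≤ x → HasDerivAt (fun x => x * (1 - A x) - c * x)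
        (x ^ 2 * (A x * deriv f x ^ 2 + A x * C x ^ 2 * f x ^ 2 + f x ^ 2) - c) x := by
      intro x hx
      exact ((h.hasDerivAt_mass (hY.trans_le hx)).sub
        ((hasDerivAt_id' x).const_mul c)).congr_deriv (by ring)
    refine monotoneOn_of_hasDerivWithinAt_nonneg
      (f' := fun x => x ^ 2 * (A x * deriv f x ^ 2 + A x * C x ^ 2 * f x ^ 2 + f x ^ 2) - c)
      (convex_Ici Y) (fun x hx => (hder x hx).continuousAt.continuousWithinAt) ?_ ?_
    · intro x hx
      rw [interior_Ici] at hx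
      exact (hder x (le_of_lt hx)).hasDerivWithinAt
    · intro x hx
      rw [interior_Ici] at hx
      have hx0 : 0 < x := hY.trans hx
      obtain ⟨-, hAx, hCx, -⟩ := h x hx0
      have h1 := hlow x (le_of_lt hx)
      have h2 : 0 ≤ x ^ 2 * (A x * deriv f x ^ 2 + A x * C x ^ 2 * f x ^ 2) := by positivity
      linarith
  have hA : ∀ x, 2 * Y ≤ x → c / 2 ≤ 1 - A x := by
    intro x hx
    have hx0 : 0 < x := by linarith
    have h1 := hmass (mem_Ici.2 le_rfl) (mem_Ici.2 (by linarith : Y ≤ x)) (by linarith)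
    simp only at h1
    have h2 := mul_pos hY (sub_pos.2 (hA1 Y hY))
    have h3 : x * (c / 2) ≤ x * (1 - A x) := by nlinarith
    exact le_of_mul_le_mul_left h3 hx0
  have hder : ∀ x, 2 * Y ≤ x → HasDerivAt (fun y => A y * C y ^ 2 + c / 2 * log y)
      (C x ^ 2 / x * (A x - 1 - x ^ 2 * A x * deriv f x ^ 2
        + x ^ 2 * f x ^ 2 * (1 - A x * C x ^ 2)) + c / 2 * x⁻¹) x := by
    intro x hx
    have hx0 : 0 < x := by linarith
    exact (h.hasDerivAt_mul_sq hx0).add ((hasDerivAt_log hx0.ne').const_mul _)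
  have hanti : AntitoneOn (fun y => A y * C y ^ 2 + c / 2 * log y) (Ici (2 * Y)) := by
    refine antitoneOn_of_hasDerivWithinAt_nonpos
      (f' := fun x => C x ^ 2 / x * (A x - 1 - x ^ 2 * A x * deriv f x ^ 2
        + x ^ 2 * f x ^ 2 * (1 - A x * C x ^ 2)) + c / 2 * x⁻¹)
      (convex_Ici _) (fun x hx => (hder x hx).continuousAt.continuousWithinAt) ?_ ?_
    · intro x hx
      rw [interior_Ici] at hx
      exact (hder x (le_of_lt hx)).hasDerivWithinAt
    · intro x hx
      rw [interior_Ici] at hx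
      have hx2 : 2 * Y ≤ x := le_of_lt hx
      have hx0 : 0 < x := by linarith
      obtain ⟨-, hAx, hCx, -⟩ := h x hx0
      have hC1 : 1 ≤ C x ^ 2 := by nlinarith [hg x hx0, hA1 x hx0, sq_nonneg (C x)]
      have h1 : A x - 1 - x ^ 2 * A x * deriv f x ^ 2
          + x ^ 2 * f x ^ 2 * (1 - A x * C x ^ 2) ≤ -(c / 2) := by
        have h2 : 0 ≤ x ^ 2 * A x * deriv f x ^ 2 := by positivity
        have h3 : x ^ 2 * f x ^ 2 * (1 - A x * C x ^ 2) ≤ 0 :=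
          mul_nonpos_of_nonneg_of_nonpos (by positivity) (by linarith [hg x hx0])
        linarith [hA x hx2]
      have h4 : C x ^ 2 * (A x - 1 - x ^ 2 * A x * deriv f x ^ 2
          + x ^ 2 * f x ^ 2 * (1 - A x * C x ^ 2)) + c / 2 ≤ 0 := by nlinarith
      calc _ = (C x ^ 2 * (A x - 1 - x ^ 2 * A x * deriv f x ^ 2
          + x ^ 2 * f x ^ 2 * (1 - A x * C x ^ 2)) + c / 2) / x := by field_simp
        _ ≤ 0 := div_nonpos_of_nonpos_of_nonneg h4 hx0.le
  have hlog : Tendsto (fun x => c / 2 * log x) atTop atTop :=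
    tendsto_log_atTop.const_mul_atTop (by positivity)
  obtain ⟨x, hx, hxY⟩ := ((hlog.eventually_gt_atTop
    (A (2 * Y) * C (2 * Y) ^ 2 + c / 2 * log (2 * Y))).and (eventually_ge_atTop (2 * Y))).exists
  have h1 := hanti (mem_Ici.2 le_rfl) (mem_Ici.2 hxY) hxY
  simp only at h1
  linarith [hg x (by linarith)]

/-- A rotation function crosses its level `θ y` upwards at every zero `y` of `f`. -/
theorem IsRotation.eventually_sign_eq {f θ : ℝ → ℝ} (hθ : IsRotation f θ (Ici 0)) {y : ℝ}
    (hy : 0 < y) (hdf : DifferentiableAt ℝ f y) (hcos : cos (θ y) = 0) :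
    ∀ᶠ x in 𝓝 y, (x < y → θ x < θ y) ∧ (y < x → θ y < θ x) := by
  obtain ⟨hcont, -, hrot⟩ := hθ
  have hsin : sin (θ y) ^ 2 = 1 := by have := sin_sq_add_cos_sq (θ y); simpa [hcos] using this
  have hsign := eventually_nhdsWithin_sign_eq_of_deriv_pos
    (f := fun x => -sin (θ y) * f x) (x₀ := y) (by
      obtain ⟨ρ, hρ, -, hd⟩ := hrot y hy.le
      rw [deriv_const_mul _ hdf, hd]
      nlinarith) (by
      obtain ⟨ρ, hρ, hfy, -⟩ := hrot y hy.le
      simp [hfy, hcos])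
  have hθy : ContinuousAt θ y := hcont.continuousAt (Ici_mem_nhds hy)
  have hnear : ∀ᶠ x in 𝓝 y, |θ x - θ y| < π := by
    have := Metric.tendsto_nhds.1 hθy π pi_pos
    simpa only [Real.dist_eq] using this
  filter_upwards [hsign, hnear, Ioi_mem_nhds hy] with x hx hxn hx0
  obtain ⟨ρ, hρ, hfx, -⟩ := hrot x (mem_Ici.2 (le_of_lt hx0))
  have hF : -sin (θ y) * f x = ρ * sin (θ x - θ y) := by
    rw [hfx, sin_sub, hcos]
    ring
  rw [hF] at hx
  rw [abs_lt] at hxn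
  constructor
  · intro hlt
    rw [sign_neg (sub_neg.2 hlt), sign_eq_neg_one_iff] at hx
    by_contra hge
    have := sin_nonneg_of_nonneg_of_le_pi (x := θ x - θ y) (by linarith) (by linarith)
    nlinarith
  · intro hlt
    rw [sign_pos (sub_pos.2 hlt), sign_eq_one_iff] at hx
    by_contra hge
    have := sin_nonpos_of_nonpos_of_neg_pi_le (x := θ x - θ y) (by linarith) (by linarith)
    nlinarith

/-- If the rotation function is bounded above, then `f` eventually has no zeros. -/
theorem IsRotation.exists_forall_ne_zero {f θ : ℝ → ℝ} (hθ : IsRotation f θ (Ici 0))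
    (hdf : ∀ x, 0 < x → DifferentiableAt ℝ f x) {K : ℝ} (hK : ∀ x, 0 ≤ x → θ x ≤ K) :
    ∃ X > 0, ∀ x, X < x → f x ≠ 0 := by
  have hcos : ∀ k : ℤ, cos (k * π + π / 2) = 0 := fun k => by
    rw [cos_add_pi_div_two, sin_int_mul_pi, neg_zero]
  obtain ⟨k, ⟨X, hX, hkX⟩, hmax⟩ := Int.exists_greatest_of_bdd
    (P := fun k : ℤ => ∃ x : ℝ, 0 < x ∧ k * π + π / 2 < θ x) (by
      refine ⟨⌈K / π⌉, ?_⟩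
      rintro k ⟨x, hx, hkx⟩
      have h1 : (k : ℝ) < K / π := by
        rw [lt_div_iff₀ pi_pos]
        linarith [hK x hx.le, pi_pos]
      exact_mod_cast (h1.trans_le (Int.le_ceil _)).le) (by
      obtain ⟨k, hk⟩ := exists_int_lt ((θ 1 - π / 2) / π)
      refine ⟨k, 1, one_pos, ?_⟩
      rw [lt_div_iff₀ pi_pos] at hk
      linarith)
  refine ⟨X, hX, fun x hx hfx => ?_⟩
  have hx0 : 0 < x := hX.trans hx
  have hlow : (k : ℝ) * π + π / 2 < θ x := by
    refine sub_pos.1 (pos_of_neg_left_of_zeros (h := fun x => θ x - (k * π + π / 2))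
      ((hθ.1.mono Ioi_subset_Ici_self).sub continuousOn_const) ?_ hX (sub_pos.2 hkX) hx.le)
    intro y hy hy0
    have hy1 : θ y = k * π + π / 2 := sub_eq_zero.1 hy0
    filter_upwards [nhdsWithin_le_nhds
      (hθ.eventually_sign_eq hy (hdf y hy) (hy1 ▸ hcos k)), self_mem_nhdsWithin] with z hz hzy
    rw [← hy1]
    exact sub_neg.2 (hz.1 hzy)
  obtain ⟨ρ, hρ, hfρ, -⟩ := hθ.2.2 x hx0.le
  have hcx : cos (θ x) = 0 := by
    rcases mul_eq_zero.1 (hfρ.symm.trans hfx) with h | h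
    · exact absurd h hρ.ne'
    · exact h
  obtain ⟨n, hn⟩ := cos_eq_zero_iff.1 hcx
  have hn' : θ x = n * π + π / 2 := by rw [hn]; ring
  have hkn : k < n := by
    rw [hn'] at hlow
    have : (k : ℝ) < n := lt_of_mul_lt_mul_right (by linarith) pi_pos.le
    exact_mod_cast this
  have hright : ∀ᶠ z in 𝓝[>] x, θ x < θ z := by
    filter_upwards [nhdsWithin_le_nhds (hθ.eventually_sign_eq hx0 (hdf x hx0) hcx),
      self_mem_nhdsWithin] with z hz hzx
    exact hz.2 hzx
  obtain ⟨z, hz, hzx⟩ := (hright.and self_mem_nhdsWithin).exists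
  exact absurd (hmax n ⟨z, hx0.trans hzx, hn' ▸ hz⟩) (not_le.2 hkn)

/-- If `A C² ≥ 1` throughout, then `f` cannot be eventually nonvanishing. -/
theorem MiniBosonSystem.not_forall_ne_zero {f A C : ℝ → ℝ} (h : MiniBosonSystem f A C (Ioi 0))
    (hA1 : ∀ x, 0 < x → A x < 1) (hg : ∀ x, 0 < x → 1 ≤ A x * C x ^ 2)
    {X : ℝ} (hX : 0 < X) : ¬ ∀ x, X < x → f x ≠ 0 := by
  intro hne
  have hC1 : ∀ x, X < x → 1 ≤ C x := by
    intro x hx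
    have hx0 : 0 < x := hX.trans hx
    obtain ⟨-, hAx, hCx, -⟩ := h x hx0
    have : 1 ≤ C x ^ 2 := by nlinarith [hg x hx0, hA1 x hx0, sq_nonneg (C x)]
    nlinarith
  have hflux : ∀ x, 0 < x → HasDerivAt (fun y => y ^ 2 * deriv f y / C y)
      (x ^ 2 / (A x * C x) * (1 - A x * C x ^ 2) * f x) x := by
    intro x hx
    obtain ⟨-, -, hCx, -, hdf', -, hdC, hf'', -⟩ := h x hx
    rw [← hf'']
    exact (((differentiableAt_id.pow 2).mul hdf').div hdC hCx.ne').hasDerivAt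
  have hcoef : ∀ x, 0 < x → x ^ 2 / (A x * C x) * (1 - A x * C x ^ 2) ≤ 0 := by
    intro x hx
    obtain ⟨-, hAx, hCx, -⟩ := h x hx
    exact mul_nonpos_of_nonneg_of_nonpos (by positivity) (by linarith [hg x hx])
  have hdf : ∀ x, X < x → HasDerivAt f (deriv f x) x := fun x hx =>
    (h x (hX.trans hx)).2.2.2.1.hasDerivAt
  have hfc : ContinuousOn f (Ioi X) := fun x hx => (hdf x hx).continuousAt.continuousWithinAt
  have hkey : ∃ c > 0, ∃ Y > X, ∀ x, Y ≤ x → c ≤ x * |f x| := by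
    rcases lt_or_gt_of_ne (hne (X + 1) (by linarith)) with hs | hs
    · have hneg : ∀ x, X < x → f x < 0 := by
        intro x hx
        by_contra hx'
        obtain ⟨z, hz, hz0⟩ := isPreconnected_Ioi.intermediate_value
          (mem_Ioi.2 (by linarith : X < X + 1)) (mem_Ioi.2 hx) hfc ⟨hs.le, not_lt.1 hx'⟩
        exact hne z hz hz0
      obtain ⟨c, hc, Y, hY, hb⟩ := exists_le_mul_of_antitoneOn (f := fun x => -f x)
        (v := fun x => -deriv f x) (C := C) hX (fun x hx => (hdf x hx).neg)
        (fun x hx => neg_pos.2 (hneg x hx)) hC1 (by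
          refine antitoneOn_of_hasDerivWithinAt_nonpos
            (f' := fun x => -(x ^ 2 / (A x * C x) * (1 - A x * C x ^ 2) * f x)) (convex_Ioi X)
            ?_ ?_ ?_
          · intro x hx
            refine ((hflux x (hX.trans hx)).continuousAt.neg.congr ?_).continuousWithinAt
            exact Eventually.of_forall fun y => by simp only [Pi.neg_apply]; ring
          · intro x hx
            rw [interior_Ioi] at hx
            refine ((hflux x (hX.trans hx)).neg.congr_of_eventuallyEq ?_).hasDerivWithinAt
            exact Eventually.of_forall fun y => by simp only [Pi.neg_apply]; ring
          · intro x hx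
            rw [interior_Ioi] at hx
            exact neg_nonpos.2 (mul_nonneg_of_nonpos_of_nonpos (hcoef x (hX.trans hx))
              (hneg x hx).le))
      refine ⟨c, hc, Y, hY, fun x hx => ?_⟩
      rw [abs_of_neg (hneg x (hY.trans_le hx))]
      exact hb x hx
    · have hpos : ∀ x, X < x → 0 < f x := by
        intro x hx
        by_contra hx'
        obtain ⟨z, hz, hz0⟩ := isPreconnected_Ioi.intermediate_value
          (mem_Ioi.2 hx) (mem_Ioi.2 (by linarith : X < X + 1)) hfc ⟨not_lt.1 hx', hs.le⟩
        exact hne z hz hz0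
      obtain ⟨c, hc, Y, hY, hb⟩ := exists_le_mul_of_antitoneOn (f := f)
        (v := deriv f) (C := C) hX hdf hpos hC1 (by
          refine antitoneOn_of_hasDerivWithinAt_nonpos
            (f' := fun x => x ^ 2 / (A x * C x) * (1 - A x * C x ^ 2) * f x) (convex_Ioi X)
            (fun x hx => (hflux x (hX.trans hx)).continuousAt.continuousWithinAt) ?_ ?_
          · intro x hx
            rw [interior_Ioi] at hx
            exact (hflux x (hX.trans hx)).hasDerivWithinAt
          · intro x hx
            rw [interior_Ioi] at hx
            exact mul_nonpos_of_nonpos_of_nonneg (hcoef x (hX.trans hx)) (hpos x hx).le)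
      refine ⟨c, hc, Y, hY, fun x hx => ?_⟩
      rw [abs_of_pos (hpos x (hY.trans_le hx))]
      exact hb x hx
  obtain ⟨c, hc, Y, hY, hb⟩ := hkey
  refine h.not_le_sq hA1 hg (pow_pos hc 2) (hX.trans hY) fun x hx => ?_
  rw [← sq_abs (f x), ← mul_pow]
  exact pow_le_pow_left₀ hc.le (hb x hx) 2

/-- For an `a`-orbit defined for all `x ≥ 0` whose rotation function is
bounded above, the function `g = 1 − A C²` is eventually positive. -/
theorem g_eventually_positive (f A C θ : ℝ → ℝ) (a α : ℝ)
    (ha : 0 < a) (hα : 1 < α)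
    (horbit : IsAOrbit f A C a α (Set.Ici 0))
    (hnv : ∀ x ∈ Set.Ici (0 : ℝ), (f x, deriv f x) ≠ (0, 0))
    (hθ : IsRotation f θ (Set.Ici 0))
    (hbd : ∃ K : ℝ, ∀ x ∈ Set.Ici (0 : ℝ), θ x ≤ K) :
    ∃ x₁ : ℝ, ∀ x : ℝ, x₁ < x → 0 < 1 - A x * C x ^ 2 := by
  obtain ⟨-, hsys, -, hA, -⟩ := horbit
  rw [Ici_sdiff_left] at hsys
  have hA1 : ∀ x, 0 < x → A x < 1 := fun x hx =>
    hsys.lt_one hA (fun y hy => hnv y (mem_Ici.2 hy.le)) hx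
  have hgd : ∀ x, 0 < x → HasDerivAt (fun y => 1 - A y * C y ^ 2) _ x := fun x hx =>
    (hsys.hasDerivAt_mul_sq hx).const_sub 1
  by_cases hex : ∃ x₀, 0 < x₀ ∧ 0 < 1 - A x₀ * C x₀ ^ 2
  · obtain ⟨x₀, hx₀, hpos⟩ := hex
    refine ⟨x₀, fun x hx => pos_of_neg_left_of_zeros (h := fun y => 1 - A y * C y ^ 2)
      (fun y hy => (hgd y hy).continuousAt.continuousWithinAt) ?_ hx₀ hpos hx.le⟩
    intro y hy hy0
    obtain ⟨-, hAy, hCy, -⟩ := hsys y hy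
    have hder : 0 < deriv (fun y => 1 - A y * C y ^ 2) y := by
      rw [(hgd y hy).deriv, hy0, neg_pos, mul_zero, add_zero]
      refine mul_neg_of_pos_of_neg (by positivity) ?_
      have : 0 ≤ y ^ 2 * A y * deriv f y ^ 2 := by positivity
      linarith [hA1 y hy]
    filter_upwards [nhdsWithin_le_nhds (eventually_nhdsWithin_sign_eq_of_deriv_pos hder hy0),
      self_mem_nhdsWithin] with z hz hzy
    rwa [sign_neg (show z - y < 0 from sub_neg.2 hzy), sign_eq_neg_one_iff] at hz
  · push Not at hex
    obtain ⟨K, hK⟩ := hbd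
    obtain ⟨X, hX, hne⟩ := hθ.exists_forall_ne_zero (fun x hx => (hsys x hx).2.2.2.1) hK
    exact absurd hne (hsys.not_forall_ne_zero hA1 (fun x hx => by linarith [hex x hx]) hX)
end
end

section
/- Let (f, A, C) be an a-orbit of the mini-boson-star system with parameters a > 0, α > 1, defined for all x ≥ 0, with (f(x), f'(x)) ≠ (0, 0) for all x, whose rotation function θ is bounded above. Then the orbit is asymptotically flat with the following leading asymptotic behavior as x → ∞: the mass function M(x) = x(1 − A(x))/2 converges to a finite limit M_∞ with 0 < M_∞ < ∞ (so A(x) → 1); C(x) converges to a limit C_∞ with 0 < C_∞ < 1; and f'(x)/f(x) converges to −√(1 − C_∞²), so f decays exponentially. -/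
open Real Set Filter Topology MeasureTheory

noncomputable section

theorem hasDerivAt_const_div (c : ℝ) {x : ℝ} (hx : x ≠ 0) :
    HasDerivAt (fun y => c / y) (-(c / x ^ 2)) x := by
  refine ((hasDerivAt_const x c).div (hasDerivAt_id x) hx).congr_deriv ?_
  simp only [id]
  ring

theorem image_le_of_hasDerivAt_nonneg {u u' : ℝ → ℝ} {a b : ℝ} (hab : a ≤ b)
    (hu : ∀ x ∈ Icc a b, HasDerivAt u (u' x) x) (hu' : ∀ x ∈ Icc a b, 0 ≤ u' x) :
    u a ≤ u b := by
  have hmono : MonotoneOn u (Icc a b) := by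
    apply monotoneOn_of_deriv_nonneg (convex_Icc a b)
    · exact fun x hx => (hu x hx).continuousAt.continuousWithinAt
    · intro x hx
      rw [interior_Icc] at hx
      exact (hu x (Ioo_subset_Icc_self hx)).differentiableAt.differentiableWithinAt
    · intro x hx
      rw [interior_Icc] at hx
      rw [(hu x (Ioo_subset_Icc_self hx)).deriv]
      exact hu' x (Ioo_subset_Icc_self hx)
  exact hmono (left_mem_Icc.2 hab) (right_mem_Icc.2 hab) hab

/-- A function that is nondecreasing whenever it lies below a level never drops below it. -/
theorem le_of_hasDerivAt_nonneg_below {u u' : ℝ → ℝ} {a c : ℝ}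
    (hu : ∀ x, a ≤ x → HasDerivAt u (u' x) x) (ha : c ≤ u a)
    (hc : ∀ x, a ≤ x → u x ≤ c → 0 ≤ u' x) {x : ℝ} (hx : a ≤ x) : c ≤ u x := by
  have key : ∀ ε > 0, -u x ≤ -c + ε * (x - a) := by
    intro ε hε
    refine image_le_of_deriv_right_lt_deriv_boundary' (f := fun y => -u y)
      (f' := fun y => -u' y) (a := a) (b := x) (B := fun y => -c + ε * (y - a))
      (B' := fun _ => ε) ?_ ?_ ?_ ?_ ?_ ?_ ⟨hx, le_rfl⟩
    · exact fun y hy => (hu y hy.1).neg.continuousAt.continuousWithinAt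
    · exact fun y hy => (hu y hy.1).neg.hasDerivWithinAt
    · simpa using ha
    · fun_prop
    · intro y _
      have := (((hasDerivAt_id y).sub_const a).const_mul ε).const_add (-c)
      simpa using this.hasDerivWithinAt
    · intro y hy h
      have h1 : 0 ≤ ε * (y - a) := mul_nonneg hε.le (by linarith [hy.1])
      have h2 := hc y hy.1 (by linarith)
      linarith
  have hlim : Tendsto (fun ε : ℝ => -c + ε * (x - a)) (𝓝[>] 0) (𝓝 (-c)) := by
    have : Continuous fun ε : ℝ => -c + ε * (x - a) := by fun_prop
    simpa using (this.tendsto 0).mono_left nhdsWithin_le_nhds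
  have := ge_of_tendsto hlim (eventually_nhdsWithin_of_forall fun ε hε => key ε hε)
  linarith

/-- A function whose derivative is `O(1/x²)` at infinity has a limit there. -/
theorem exists_tendsto_of_abs_deriv_le_div_sq {u u' : ℝ → ℝ} {a B : ℝ} (ha : 0 < a)
    (hu : ∀ x, a ≤ x → HasDerivAt u (u' x) x) (hB : ∀ x, a ≤ x → |u' x| ≤ B / x ^ 2) :
    ∃ l, Tendsto u atTop (𝓝 l) := by
  have hdiv : ∀ x, a ≤ x → HasDerivAt (fun y => B / y) (-(B / x ^ 2)) x := fun x hx =>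
    hasDerivAt_const_div B (ha.trans_le hx).ne'
  have hB0 : 0 ≤ B := by
    have h := (abs_nonneg _).trans (hB a le_rfl)
    rcases le_or_gt 0 B with h1 | h1
    · exact h1
    · exact absurd h (not_le.2 (div_neg_of_neg_of_pos h1 (by positivity)))
  have hlow : ∀ x y, a ≤ x → x ≤ y → u x - B / x ≤ u y - B / y := by
    intro x y hx hxy
    refine image_le_of_hasDerivAt_nonneg (u := fun y => u y - B / y) hxy
      (fun z hz => (hu z (hx.trans hz.1)).sub (hdiv z (hx.trans hz.1))) (fun z hz => ?_)
    linarith [neg_abs_le (u' z), hB z (hx.trans hz.1)]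
  have hupp : ∀ x, a ≤ x → u x ≤ u a + B / a := by
    intro x hx
    have := image_le_of_hasDerivAt_nonneg (u := fun y => -u y - B / y) hx
      (fun z hz => (hu z hz.1).neg.sub (hdiv z hz.1))
      (fun z hz => by linarith [le_abs_self (u' z), hB z hz.1])
    have h2 : 0 ≤ B / x := div_nonneg hB0 (ha.le.trans hx)
    linarith
  have hmono : Monotone fun x => u (max x a) - B / max x a := fun x y hxy =>
    hlow _ _ (le_max_right _ _) (max_le_max_right a hxy)
  have hbdd : BddAbove (range fun x => u (max x a) - B / max x a) := by
    refine ⟨u a + B / a, ?_⟩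
    rintro _ ⟨x, rfl⟩
    have h1 := hupp _ (le_max_right x a)
    have h2 : 0 ≤ B / max x a := div_nonneg hB0 (ha.le.trans (le_max_right _ _))
    linarith
  have hlim := tendsto_atTop_ciSup hmono hbdd
  have hB' : Tendsto (fun x : ℝ => B / x) atTop (𝓝 0) := tendsto_const_nhds.div_atTop tendsto_id
  refine ⟨_, (hlim.add hB').congr' ?_⟩
  filter_upwards [eventually_ge_atTop a] with x hx
  rw [max_eq_left hx]
  ring

/-- A positive global solution of a Riccati equation `u' = p u² + e u - q` with `e → 0` eventually
exceeds every level `b` at which the limiting right-hand side is negative. -/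
theorem eventually_lt_of_riccati {u p e q : ℝ → ℝ} {X b p₀ q₀ : ℝ}
    (hu0 : ∀ x, X ≤ x → 0 < u x) (hp0 : ∀ x, X ≤ x → 0 ≤ p x)
    (hu : ∀ x, X ≤ x → HasDerivAt u (p x * u x ^ 2 + e x * u x - q x) x)
    (hp : Tendsto p atTop (𝓝 p₀)) (he : Tendsto e atTop (𝓝 0)) (hq : Tendsto q atTop (𝓝 q₀))
    (hb : 0 < b) (hbq : p₀ * b ^ 2 < q₀) : ∀ᶠ x in atTop, b < u x := by
  obtain ⟨c, hc0, hc⟩ : ∃ c > 0, p₀ * b ^ 2 + |0| * b - q₀ < -c :=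
    ⟨(q₀ - p₀ * b ^ 2) / 2, by linarith, by simp; linarith⟩
  have hlim : Tendsto (fun x => p x * b ^ 2 + |e x| * b - q x) atTop
      (𝓝 (p₀ * b ^ 2 + |0| * b - q₀)) :=
    ((hp.mul_const _).add (he.abs.mul_const b)).sub hq
  obtain ⟨Y, hY⟩ := eventually_atTop.1 ((hlim.eventually_lt_const hc).and (eventually_ge_atTop X))
  filter_upwards [eventually_ge_atTop Y] with x hx
  by_contra! hux
  have key : ∀ y, x ≤ y → u y ≤ b + -c * (y - x) := by
    intro y hy
    refine image_le_of_deriv_right_lt_deriv_boundary' (f := u)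
      (f' := fun y => p y * u y ^ 2 + e y * u y - q y) (a := x) (b := y)
      (B := fun y => b + -c * (y - x)) (B' := fun _ => -c) ?_ ?_ ?_ ?_ ?_ ?_ ⟨hy, le_rfl⟩
    · exact fun z hz => (hu z (hY z (hx.trans hz.1)).2).continuousAt.continuousWithinAt
    · exact fun z hz => (hu z (hY z (hx.trans hz.1)).2).hasDerivWithinAt
    · simpa using hux
    · fun_prop
    · intro z _
      have := (((hasDerivAt_id z).sub_const x).const_mul (-c)).const_add b
      simpa using this.hasDerivWithinAt
    · intro z hz h
      obtain ⟨h1, h2⟩ := hY z (hx.trans hz.1)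
      have hz0 := hu0 z h2
      have hzb : u z ≤ b := by
        have : 0 ≤ c * (z - x) := mul_nonneg hc0.le (by linarith [hz.1])
        linarith
      have h3 : p z * u z ^ 2 ≤ p z * b ^ 2 := by
        have := hp0 z h2
        gcongr
      have h4 : e z * u z ≤ |e z| * b :=
        mul_le_mul (le_abs_self _) hzb hz0.le (abs_nonneg _)
      linarith
  have h1 := key (x + b / c) (by linarith [div_pos hb hc0])
  have h2 := hu0 (x + b / c) (by linarith [div_pos hb hc0, (hY x hx).2])
  have h3 : -c * (x + b / c - x) = -b := by field_simp; ring
  rw [h3] at h1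
  linarith

/-- A positive global solution of `u' = u² + e u - q` with `e → 0` and `q → k²` tends to `k`. -/
theorem tendsto_of_riccati {u e q : ℝ → ℝ} {X k : ℝ} (hk : 0 < k)
    (hu0 : ∀ x, X ≤ x → 0 < u x) (hq0 : ∀ x, X ≤ x → 0 ≤ q x)
    (hu : ∀ x, X ≤ x → HasDerivAt u (u x ^ 2 + e x * u x - q x) x)
    (he : Tendsto e atTop (𝓝 0)) (hq : Tendsto q atTop (𝓝 (k ^ 2))) :
    Tendsto u atTop (𝓝 k) := by
  refine tendsto_order.2 ⟨fun b hb => ?_, fun b hb => ?_⟩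
  · have hlt : max b (k / 2) < k := max_lt hb (by linarith)
    have hpos : 0 < max b (k / 2) := lt_max_of_lt_right (by linarith)
    have := eventually_lt_of_riccati (p := fun _ => 1) hu0 (fun _ _ => zero_le_one)
      (by simpa using hu) tendsto_const_nhds he hq hpos (by rw [one_mul]; gcongr)
    filter_upwards [this] with x hx
    exact (le_max_left _ _).trans_lt hx
  · have hb0 : 0 < b := hk.trans hb
    have hinv : ∀ x, X ≤ x → HasDerivAt (fun y => (u y)⁻¹)
        (q x * (u x)⁻¹ ^ 2 + -e x * (u x)⁻¹ - 1) x := by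
      intro x hx
      have h0 := (hu0 x hx).ne'
      refine ((hu x hx).inv h0).congr_deriv ?_
      field_simp
      ring
    have := eventually_lt_of_riccati (u := fun y => (u y)⁻¹) (e := fun x => -e x)
      (q := fun _ => 1) (b := b⁻¹) (fun x hx => inv_pos.2 (hu0 x hx)) hq0 hinv hq
      (by simpa using he.neg) tendsto_const_nhds (inv_pos.2 hb0) (by
        rw [inv_pow, ← div_eq_mul_inv, div_lt_one (by positivity)]
        gcongr)
    filter_upwards [this, eventually_ge_atTop X] with x hx hX
    exact (inv_lt_inv₀ hb0 (hu0 x hX)).1 hx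

/-- A solution of the system in first-order form (`g` stands for `f'`) on a half-line `[X, ∞)` on
which the scalar field is positive, with positive mass at `X`. -/
structure PositiveTail (f g A C : ℝ → ℝ) (X : ℝ) : Prop where
  pos : 0 < X
  A_pos : ∀ x, X ≤ x → 0 < A x
  C_pos : ∀ x, X ≤ x → 0 < C x
  f_pos : ∀ x, X ≤ x → 0 < f x
  hasDerivAt_f : ∀ x, X ≤ x → HasDerivAt f (g x) x
  hasDerivAt_g : ∀ x, X ≤ x → HasDerivAt g
    (g x * (-2 / x + (A x - 1 + x ^ 2 * f x ^ 2) / (x * A x))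
      + (1 - A x * C x ^ 2) * f x / A x) x
  hasDerivAt_A : ∀ x, X ≤ x → HasDerivAt A ((1 - A x) / x
    - x * (A x * g x ^ 2 + A x * C x ^ 2 * f x ^ 2 + f x ^ 2)) x
  hasDerivAt_C : ∀ x, X ≤ x → HasDerivAt C
    (C x / (x * A x) * (A x - 1 + x ^ 2 * f x ^ 2)) x
  mass_pos : 0 < massFn A X

theorem hasDerivAt_massFn {A : ℝ → ℝ} {x s : ℝ} (hx : x ≠ 0)
    (hA : HasDerivAt A ((1 - A x) / x - x * s) x) :
    HasDerivAt (massFn A) (x ^ 2 / 2 * s) x := by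
  have h := ((hasDerivAt_id x).mul (hA.const_sub 1)).div_const 2
  refine h.congr_deriv ?_
  simp only [id]
  field_simp
  ring

namespace PositiveTail

variable {f g A C : ℝ → ℝ} {X : ℝ}

theorem hasDerivAt_mass (h : PositiveTail f g A C X) {x : ℝ} (hx : X ≤ x) :
    HasDerivAt (massFn A)
      (x ^ 2 / 2 * (A x * g x ^ 2 + A x * C x ^ 2 * f x ^ 2 + f x ^ 2)) x :=
  hasDerivAt_massFn (h.pos.trans_le hx).ne' (h.hasDerivAt_A x hx)

theorem hasDerivAt_flux (h : PositiveTail f g A C X) {x : ℝ} (hx : X ≤ x) :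
    HasDerivAt (fun y => y ^ 2 * g y / C y)
      (x ^ 2 / (A x * C x) * (1 - A x * C x ^ 2) * f x) x := by
  have hA := (h.A_pos x hx).ne'
  have hC := (h.C_pos x hx).ne'
  have hx0 := (h.pos.trans_le hx).ne'
  refine ((((hasDerivAt_id x).pow 2).mul (h.hasDerivAt_g x hx)).div
    (h.hasDerivAt_C x hx) hC).congr_deriv ?_
  simp
  field_simp
  ring

theorem hasDerivAt_mul (h : PositiveTail f g A C X) {x : ℝ} (hx : X ≤ x) :
    HasDerivAt (fun y => A y * C y) (-(x * (A x * C x) * (g x ^ 2 + C x ^ 2 * f x ^ 2))) x := by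
  have hA := (h.A_pos x hx).ne'
  have hx0 := (h.pos.trans_le hx).ne'
  refine ((h.hasDerivAt_A x hx).mul (h.hasDerivAt_C x hx)).congr_deriv ?_
  field_simp
  ring

theorem hasDerivAt_mul_sq (h : PositiveTail f g A C X) {x : ℝ} (hx : X ≤ x) :
    HasDerivAt (fun y => A y * C y ^ 2) (A x * C x ^ 2 * (-(x * g x ^ 2)
      + x * f x ^ 2 / A x * (1 - A x * C x ^ 2) - (1 - A x) / (x * A x))) x := by
  have hA := (h.A_pos x hx).ne'
  have hx0 := (h.pos.trans_le hx).ne'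
  refine ((h.hasDerivAt_A x hx).mul ((h.hasDerivAt_C x hx).pow 2)).congr_deriv ?_
  simp
  field_simp
  ring

theorem mass_mono (h : PositiveTail f g A C X) {x y : ℝ} (hx : X ≤ x) (hxy : x ≤ y) :
    massFn A x ≤ massFn A y :=
  image_le_of_hasDerivAt_nonneg hxy (fun z hz => h.hasDerivAt_mass (hx.trans hz.1))
    (fun z hz => by have := h.A_pos z (hx.trans hz.1); positivity)

theorem mono (h : PositiveTail f g A C X) {Y : ℝ} (hY : X ≤ Y) : PositiveTail f g A C Y where
  pos := h.pos.trans_le hY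
  A_pos x hx := h.A_pos x (hY.trans hx)
  C_pos x hx := h.C_pos x (hY.trans hx)
  f_pos x hx := h.f_pos x (hY.trans hx)
  hasDerivAt_f x hx := h.hasDerivAt_f x (hY.trans hx)
  hasDerivAt_g x hx := h.hasDerivAt_g x (hY.trans hx)
  hasDerivAt_A x hx := h.hasDerivAt_A x (hY.trans hx)
  hasDerivAt_C x hx := h.hasDerivAt_C x (hY.trans hx)
  mass_pos := h.mass_pos.trans_le (h.mass_mono le_rfl hY)

theorem two_mass_div_le (h : PositiveTail f g A C X) {x : ℝ} (hx : X ≤ x) :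
    2 * massFn A X / x ≤ 1 - A x := by
  have h0 := h.pos.trans_le hx
  rw [div_le_iff₀ h0]
  have := h.mass_mono le_rfl hx
  simp only [massFn] at this ⊢
  linarith

theorem A_lt_one (h : PositiveTail f g A C X) {x : ℝ} (hx : X ≤ x) : A x < 1 := by
  have h1 := h.two_mass_div_le hx
  have h2 : 0 < 2 * massFn A X / x :=
    div_pos (by linarith [h.mass_pos]) (h.pos.trans_le hx)
  linarith

theorem mul_le (h : PositiveTail f g A C X) {x : ℝ} (hx : X ≤ x) :
    A x * C x ≤ A X * C X := by
  have := image_le_of_hasDerivAt_nonneg (u := fun y => -(A y * C y)) hx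
    (fun z hz => (h.hasDerivAt_mul hz.1).neg) (fun z hz => by
      have := h.A_pos z hz.1
      have := h.C_pos z hz.1
      have := h.pos.trans_le hz.1
      rw [neg_neg]
      positivity)
  linarith

/-- A positive field cannot persist while `A C² ≥ 1`: the equation for `f` would be oscillatory. -/
theorem exists_mul_sq_lt_one (h : PositiveTail f g A C X) : ∃ x, X ≤ x ∧ A x * C x ^ 2 < 1 := by
  by_contra! hW
  set m := massFn A X with hm
  have hm0 : 0 < m := h.mass_pos
  set β := A X * C X with hβ
  have hβ0 : 0 < β := mul_pos (h.A_pos X le_rfl) (h.C_pos X le_rfl)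
  have hdiv : ∀ c x : ℝ, X ≤ x → HasDerivAt (fun y => c / y) (-(c / x ^ 2)) x := fun c x hx =>
    hasDerivAt_const_div c (h.pos.trans_le hx).ne'
  have hWlow : ∀ x, X ≤ x → 2 * m / x ≤ A x * C x ^ 2 - 1 := by
    intro x hx
    have key : ∀ y, x ≤ y → 1 - 2 * m / y ≤ A x * C x ^ 2 - 2 * m / x := by
      intro y hy
      have := image_le_of_hasDerivAt_nonneg (u := fun y => 2 * m / y - A y * C y ^ 2) hy
        (fun z hz => (hdiv (2 * m) z (hx.trans hz.1)).sub (h.hasDerivAt_mul_sq (hx.trans hz.1)))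
        (fun z hz => by
          have hz1 := hx.trans hz.1
          have hz0 := h.pos.trans_le hz1
          have hA0 := h.A_pos z hz1
          have hA1 := h.A_lt_one hz1
          have hM := h.two_mass_div_le hz1
          have hWz := hW z hz1
          have e1 : 2 * m / z ^ 2 ≤ (1 - A z) / (z * A z) := by
            rw [show 2 * m / z ^ 2 = (2 * m / z) / z by field_simp]
            apply div_le_div₀ (by linarith) hM (by positivity)
            nlinarith
          have e2 : z * f z ^ 2 / A z * (1 - A z * C z ^ 2) ≤ 0 :=
            mul_nonpos_of_nonneg_of_nonpos (by positivity) (by linarith)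
          have e3 : 0 ≤ z * g z ^ 2 := by positivity
          have e4 : 0 < 2 * m / z ^ 2 := by positivity
          nlinarith)
      linarith [hW y (hx.trans hy)]
    have hlim : Tendsto (fun y : ℝ => 1 - 2 * m / y) atTop (𝓝 (1 - 0)) :=
      tendsto_const_nhds.sub (tendsto_const_nhds.div_atTop tendsto_id)
    have := le_of_tendsto hlim ((eventually_ge_atTop x).mono key)
    linarith
  set R : ℝ → ℝ := fun y => -(y ^ 2 * g y / C y) / f y with hR
  set R' : ℝ → ℝ := fun x => x ^ 2 * (A x * C x ^ 2 - 1) / (A x * C x) + R x ^ 2 * C x / x ^ 2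
    with hR'
  have hRd : ∀ x, X ≤ x → HasDerivAt R (R' x) x := by
    intro x hx
    have hf0 := (h.f_pos x hx).ne'
    have hA0 := (h.A_pos x hx).ne'
    have hC0 := (h.C_pos x hx).ne'
    have hx0 := (h.pos.trans_le hx).ne'
    refine ((h.hasDerivAt_flux hx).neg.div (h.hasDerivAt_f x hx) hf0).congr_deriv ?_
    simp only [hR', hR, Pi.neg_apply]
    field_simp
    ring
  have hR1 : ∀ x, X ≤ x → 2 * m / β * x ≤ x ^ 2 * (A x * C x ^ 2 - 1) / (A x * C x) := by
    intro x hx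
    have hx0 := h.pos.trans_le hx
    have hA0 := h.A_pos x hx
    have hC0 := h.C_pos x hx
    have e : 2 * m / β * x = x ^ 2 * (2 * m / x) / β := by field_simp
    rw [e]
    apply div_le_div₀ _ _ (by positivity) (h.mul_le hx)
    · have := hW x hx
      exact mul_nonneg (by positivity) (by linarith)
    · exact mul_le_mul_of_nonneg_left (hWlow x hx) (by positivity)
  have hR2 : ∀ x, X ≤ x → R x ^ 2 / x ^ 2 ≤ R x ^ 2 * C x / x ^ 2 := by
    intro x hx
    have hC0 := h.C_pos x hx
    have hC1 : 1 ≤ C x := by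
      by_contra! hC
      have h1 : C x ^ 2 < 1 := by nlinarith
      nlinarith [hW x hx, h.A_lt_one hx, h.A_pos x hx]
    gcongr
    nlinarith [sq_nonneg (R x)]
  have hRlow : ∀ x, X ≤ x → R X - m / β * X ^ 2 + m / β * x ^ 2 ≤ R x := by
    intro x hx
    have := image_le_of_hasDerivAt_nonneg (u := fun y => R y - m / β * y ^ 2) hx
      (fun z hz => (hRd z hz.1).sub (((hasDerivAt_id z).pow 2).const_mul (m / β)))
      (fun z hz => by
        have e1 := hR1 z hz.1
        have e2 := hR2 z hz.1
        have e3 : 0 ≤ R z ^ 2 / z ^ 2 := by positivity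
        have e4 : m / β * (((2 : ℕ) : ℝ) * id z ^ (2 - 1) * 1) = 2 * m / β * z := by
          simp; ring
        rw [e4]
        simp only [hR']
        linarith)
    linarith
  obtain ⟨x₁, hx₁, hRx₁⟩ : ∃ x, X ≤ x ∧ x < R x := by
    have hk : 0 < m / β := by positivity
    set k := m / β
    set d := R X - k * X ^ 2
    have hX := h.pos
    have hp : 0 < (1 + |d|) / k := by positivity
    have hp' : 0 < 1 / k := by positivity
    obtain ⟨x, hx⟩ : ∃ x, x = X + 1 + 1 / k + (1 + |d|) / k := ⟨_, rfl⟩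
    have hkx : k * x = k * X + k + 1 + (1 + |d|) := by rw [hx]; field_simp
    refine ⟨x, by linarith, lt_of_lt_of_le ?_ (hRlow x (by linarith))⟩
    have h1 : 1 + |d| ≤ k * x - 1 := by
      have : 0 < k * X := by positivity
      linarith
    have h2 : 1 * (k * x - 1) ≤ x * (k * x - 1) := by
      apply mul_le_mul_of_nonneg_right (by linarith)
      linarith [abs_nonneg d]
    have h3 := neg_abs_le d
    change x < d + k * x ^ 2
    nlinarith
  have hx₁0 := h.pos.trans_le hx₁
  have hRpos : ∀ y, x₁ ≤ y → 0 < R y := by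
    intro y hy
    have := image_le_of_hasDerivAt_nonneg hy (fun z hz => hRd z (hx₁.trans hz.1)) (fun z hz => by
      have hz1 := hx₁.trans hz.1
      have hz0 := h.pos.trans_le hz1
      have e3 : 0 ≤ R z ^ 2 / z ^ 2 := by positivity
      have e4 : 0 ≤ 2 * m / β * z := by positivity
      simp only [hR']
      linarith [hR1 z hz1, hR2 z hz1])
    linarith
  have hfin : ∀ y, x₁ ≤ y → 1 / x₁ - (R x₁)⁻¹ ≤ 1 / y := by
    intro y hy
    have := image_le_of_hasDerivAt_nonneg (u := fun y => 1 / y - (R y)⁻¹) hy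
      (fun z hz => (hdiv 1 z (hx₁.trans hz.1)).sub
        ((hRd z (hx₁.trans hz.1)).inv (hRpos z hz.1).ne')) (fun z hz => by
      have hz1 := hx₁.trans hz.1
      have hz0 := h.pos.trans_le hz1
      have hRz := hRpos z hz.1
      have e4 : 0 ≤ 2 * m / β * z := by positivity
      have e5 : R z ^ 2 / z ^ 2 ≤ R' z := by
        simp only [hR']
        linarith [hR1 z hz1, hR2 z hz1]
      have e6 : 1 / z ^ 2 ≤ R' z / R z ^ 2 := by
        rw [le_div_iff₀ (by positivity)]
        rwa [one_div_mul_eq_div]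
      rw [neg_div]
      linarith)
    have h2 := inv_pos.2 (hRpos y hy)
    linarith
  have hlim : Tendsto (fun y : ℝ => 1 / y) atTop (𝓝 0) := tendsto_const_nhds.div_atTop tendsto_id
  have h1 := ge_of_tendsto hlim ((eventually_ge_atTop x₁).mono hfin)
  have h2 : (R x₁)⁻¹ < 1 / x₁ := by
    rw [one_div]
    exact inv_strictAnti₀ hx₁0 hRx₁
  linarith

theorem mul_sq_le_one (h : PositiveTail f g A C X) (hX : A X * C X ^ 2 < 1) {x : ℝ}
    (hx : X ≤ x) : A x * C x ^ 2 ≤ 1 := by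
  refine image_le_of_deriv_right_lt_deriv_boundary' (f := fun y => A y * C y ^ 2)
    (a := X) (b := x) (B := fun _ => 1) (B' := fun _ => 0) ?_
    (fun y hy => (h.hasDerivAt_mul_sq hy.1).hasDerivWithinAt) hX.le continuousOn_const
    (fun y _ => hasDerivWithinAt_const _ _ _) ?_ ⟨hx, le_rfl⟩
  · exact fun y hy => (h.hasDerivAt_mul_sq hy.1).continuousAt.continuousWithinAt
  · intro y hy hW
    have hy0 := h.pos.trans_le hy.1
    have h1 : 0 < (1 - A y) / (y * A y) :=
      div_pos (by linarith [h.A_lt_one hy.1]) (mul_pos hy0 (h.A_pos y hy.1))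
    have h2 : 0 ≤ y * g y ^ 2 := by positivity
    rw [hW]
    linarith

theorem sq_mul_cube_sub_cube_le (h : PositiveTail f g A C X) {c z x : ℝ} (hc : 0 ≤ c)
    (hz : X ≤ z) (hzx : z ≤ x) (hf : ∀ s ∈ Icc z x, c ≤ f s) :
    c ^ 2 * (x ^ 3 - z ^ 3) ≤ 3 * x := by
  have hx0 := h.pos.trans_le (hz.trans hzx)
  have h1 := image_le_of_hasDerivAt_nonneg (u := fun y => massFn A y - c ^ 2 / 6 * y ^ 3) hzx
    (fun s hs => (h.hasDerivAt_mass (hz.trans hs.1)).sub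
      (((hasDerivAt_id s).pow 3).const_mul (c ^ 2 / 6))) (fun s hs => by
        have hA := h.A_pos s (hz.trans hs.1)
        have e1 : c ^ 2 / 6 * (((3 : ℕ) : ℝ) * id s ^ (3 - 1) * 1) = s ^ 2 / 2 * c ^ 2 := by
          simp; ring
        have e2 : c ^ 2 ≤ f s ^ 2 := by
          have := hf s hs
          gcongr
        have e3 : 0 ≤ A s * g s ^ 2 + A s * C s ^ 2 * f s ^ 2 := by positivity
        rw [e1, sub_nonneg]
        apply mul_le_mul_of_nonneg_left _ (by positivity)
        linarith)
  have h2 : 0 < massFn A z := h.mass_pos.trans_le (h.mass_mono le_rfl hz)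
  have h3 : massFn A x ≤ x / 2 := by
    have := mul_pos hx0 (h.A_pos x (hz.trans hzx))
    simp only [massFn]
    linarith
  linarith

theorem flux_mono (h : PositiveTail f g A C X) (hX : A X * C X ^ 2 < 1) {x y : ℝ}
    (hx : X ≤ x) (hxy : x ≤ y) : x ^ 2 * g x / C x ≤ y ^ 2 * g y / C y := by
  refine image_le_of_hasDerivAt_nonneg (u := fun y => y ^ 2 * g y / C y) hxy
    (fun z hz => h.hasDerivAt_flux (hx.trans hz.1)) (fun z hz => ?_)
  have hz := hx.trans hz.1
  have h1 := h.A_pos z hz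
  have h2 := h.C_pos z hz
  have h3 := h.f_pos z hz
  have h4 : 0 ≤ 1 - A z * C z ^ 2 := by linarith [h.mul_sq_le_one hX hz]
  positivity

theorem g_neg (h : PositiveTail f g A C X) (hX : A X * C X ^ 2 < 1) {x : ℝ} (hx : X ≤ x) :
    g x < 0 := by
  by_contra! hg
  have hx0 := h.pos.trans_le hx
  have hC := h.C_pos x hx
  have hg' : ∀ y, x ≤ y → 0 ≤ g y := by
    intro y hy
    have h1 := h.flux_mono hX hx hy
    have h2 : 0 ≤ x ^ 2 * g x / C x := by positivity
    by_contra! hy'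
    have hC' := h.C_pos y (hx.trans hy)
    have hy0 := h.pos.trans_le (hx.trans hy)
    have : y ^ 2 * g y / C y < 0 :=
      div_neg_of_neg_of_pos (mul_neg_of_pos_of_neg (by positivity) hy') hC'
    linarith
  have hf' : ∀ y, x ≤ y → f x ≤ f y := fun y hy =>
    image_le_of_hasDerivAt_nonneg hy (fun z hz => h.hasDerivAt_f z (hx.trans hz.1))
      (fun z hz => hg' z hz.1)
  have hf := h.f_pos x hx
  have key : ∀ y, x ≤ y → f x ^ 2 * (y ^ 3 - x ^ 3) ≤ 3 * y := fun y hy =>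
    h.sq_mul_cube_sub_cube_le hf.le hx hy (fun s hs => hf' s hs.1)
  obtain ⟨y, hy⟩ : ∃ y, y = 2 * x + 2 / f x := ⟨_, rfl⟩
  have hd : 0 < 2 / f x := by positivity
  have h1 := key y (by linarith)
  have hy0 : 0 < y := by linarith
  have h2 : x ^ 3 ≤ (y / 2) ^ 3 := by
    gcongr
    linarith
  have h3 : 2 ≤ f x * y := by
    rw [hy]
    have : f x * (2 * x + 2 / f x) = 2 * (f x * x) + 2 := by field_simp
    rw [this]
    have := mul_pos hf hx0
    linarith
  have h4 : f x ^ 2 * (7 / 8 * y ^ 3) ≤ 3 * y := by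
    refine le_trans ?_ h1
    gcongr
    linarith
  have h5 : 4 ≤ (f x * y) ^ 2 := by nlinarith
  have h6 : f x ^ 2 * (7 / 8 * y ^ 3) = 7 / 8 * (f x * y) ^ 2 * y := by ring
  rw [h6] at h4
  nlinarith

theorem f_anti (h : PositiveTail f g A C X) (hX : A X * C X ^ 2 < 1) {x y : ℝ}
    (hx : X ≤ x) (hxy : x ≤ y) : f y ≤ f x := by
  have := image_le_of_hasDerivAt_nonneg (u := fun y => -f y) hxy
    (fun z hz => (h.hasDerivAt_f z (hx.trans hz.1)).neg)
    (fun z hz => by linarith [h.g_neg hX (hx.trans hz.1)])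
  linarith

theorem exists_mul_f_le (h : PositiveTail f g A C X) (hX : A X * C X ^ 2 < 1) :
    ∃ Y > 0, ∀ x, X ≤ x → x * f x ≤ Y := by
  refine ⟨max 2 (2 * X * f X), lt_max_of_lt_left two_pos, fun x hx => ?_⟩
  have hx0 := h.pos.trans_le hx
  have hf := h.f_pos x hx
  rcases le_total x (2 * X) with hx2 | hx2
  · refine le_max_of_le_right ?_
    exact mul_le_mul hx2 (h.f_anti hX le_rfl hx) hf.le (by linarith [h.pos])
  · refine le_max_of_le_left ?_
    have h1 := h.sq_mul_cube_sub_cube_le (z := x / 2) (x := x) hf.le (by linarith) (by linarith)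
      (fun s hs => h.f_anti hX (by linarith [hs.1]) hs.2)
    have h2 : f x ^ 2 * (x ^ 3 - (x / 2) ^ 3) = 7 / 8 * (x * f x) ^ 2 * x := by ring
    rw [h2] at h1
    have h3 : 7 / 8 * (x * f x) ^ 2 ≤ 3 := le_of_mul_le_mul_right h1 hx0
    have : 0 < x * f x := by positivity
    nlinarith

/-- `A C²` stays bounded away from `1`. -/
theorem exists_le_one_sub_mul_sq (h : PositiveTail f g A C X) (hX : A X * C X ^ 2 < 1) :
    ∃ δ > 0, ∀ x, X ≤ x → δ ≤ 1 - A x * C x ^ 2 := by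
  obtain ⟨Y, hY0, hY⟩ := h.exists_mul_f_le hX
  set m := massFn A X with hm
  have hm0 : 0 < m := h.mass_pos
  set β := A X * C X with hβ
  have hβ0 : 0 < β := mul_pos (h.A_pos X le_rfl) (h.C_pos X le_rfl)
  have hX0 := h.pos
  obtain ⟨κ, hκ⟩ : ∃ κ, κ = β * Y ^ 3 / (m * X) := ⟨_, rfl⟩
  have hκ0 : 0 < κ := by rw [hκ]; positivity
  set P : ℝ → ℝ := fun y => y ^ 2 * g y / C y with hP
  have hPneg : ∀ x, X ≤ x → P x < 0 := fun x hx =>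
    div_neg_of_neg_of_pos (mul_neg_of_pos_of_neg (by have := h.pos.trans_le hx; positivity)
      (h.g_neg hX hx)) (h.C_pos x hx)
  set D' : ℝ → ℝ := fun x => -(A x * C x ^ 2 * (-(x * g x ^ 2)
      + x * f x ^ 2 / A x * (1 - A x * C x ^ 2) - (1 - A x) / (x * A x))) with hD'
  set P' : ℝ → ℝ := fun x => x ^ 2 / (A x * C x) * (1 - A x * C x ^ 2) * f x with hP'
  set H : ℝ → ℝ := fun x => (1 - A x * C x ^ 2) * exp (κ * P x) with hH
  have hHd : ∀ x, X ≤ x → HasDerivAt H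
      ((D' x + κ * P' x * (1 - A x * C x ^ 2)) * exp (κ * P x)) x := by
    intro x hx
    refine (((h.hasDerivAt_mul_sq hx).const_sub 1).mul
      ((h.hasDerivAt_flux hx).const_mul κ).exp).congr_deriv ?_
    simp only [hD', hP', hP]
    ring
  obtain ⟨c, hc⟩ : ∃ c, c = min (H X) (exp (κ * P X) / (4 * Y ^ 2)) := ⟨_, rfl⟩
  have hHX : 0 < H X := mul_pos (by linarith) (exp_pos _)
  have hc0 : 0 < c := by
    rw [hc]
    exact lt_min hHX (by positivity)
  have hlow : ∀ x, X ≤ x → c ≤ H x := by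
    intro x hx
    refine le_of_hasDerivAt_nonneg_below hHd (hc ▸ min_le_left _ _) ?_ hx
    clear x hx
    intro x hx hHx
    refine mul_nonneg ?_ (exp_pos _).le
    have hx0 := h.pos.trans_le hx
    have hA0 := h.A_pos x hx
    have hC0 := h.C_pos x hx
    have hf0 := h.f_pos x hx
    have hδ0 : 0 ≤ 1 - A x * C x ^ 2 := by linarith [h.mul_sq_le_one hX hx]
    have hW1 := h.mul_sq_le_one hX hx
    obtain ⟨d, hd⟩ : ∃ d, d = 1 - A x * C x ^ 2 := ⟨_, rfl⟩
    have hP'0 : 0 ≤ P' x := by simp only [hP']; positivity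
    have hyY := hY x hx
    have hM := h.two_mass_div_le hx
    rw [← hm] at hM
    have hD'e : D' x = A x * C x ^ 2 * (x * g x ^ 2)
        + A x * C x ^ 2 / (x * A x) * ((1 - A x) - (x * f x) ^ 2 * d) := by
      simp only [hD']
      rw [← hd]
      field_simp
      ring
    rw [← hd] at hδ0 ⊢
    have hg0 : 0 ≤ A x * C x ^ 2 * (x * g x ^ 2) := by positivity
    rcases le_or_gt ((x * f x) ^ 2 * d) (1 - A x) with hcase | hcase
    · have h1 : 0 ≤ A x * C x ^ 2 / (x * A x) * ((1 - A x) - (x * f x) ^ 2 * d) :=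
        mul_nonneg (by positivity) (by linarith)
      rw [hD'e]
      positivity
    · have hY2 : (x * f x) ^ 2 ≤ Y ^ 2 := by gcongr
      have hAhalf : 1 / 2 ≤ A x := by
        by_contra! hA
        have h1 : 1 / 2 < Y ^ 2 * d := by nlinarith
        have h2 : H x ≤ exp (κ * P X) / (4 * Y ^ 2) := hHx.trans (hc ▸ min_le_right _ _)
        have h3 : exp (κ * P X) ≤ exp (κ * P x) := by
          have := h.flux_mono hX le_rfl hx
          gcongr
        have h4 : H x = d * exp (κ * P x) := by rw [hd]
        rw [h4, le_div_iff₀ (by positivity)] at h2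
        nlinarith [exp_pos (κ * P x)]
      have hdM : 2 * m / x ≤ (x * f x) ^ 2 * d := hM.trans hcase.le
      have hdm : 2 * m ≤ x ^ 3 * f x ^ 2 * d := by
        rw [div_le_iff₀ hx0] at hdM
        linarith
      have h1 : D' x ≥ -(2 * x * f x ^ 2 * d) := by
        have e1 : A x * C x ^ 2 / (x * A x) * ((1 - A x) - (x * f x) ^ 2 * d)
            ≥ -(A x * C x ^ 2 / (x * A x) * ((x * f x) ^ 2 * d)) := by
          have : 0 ≤ A x * C x ^ 2 / (x * A x) * (1 - A x) :=
            mul_nonneg (by positivity) (by linarith [h.A_lt_one hx])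
          linarith
        have e2 : A x * C x ^ 2 / (x * A x) * ((x * f x) ^ 2 * d)
            ≤ 1 / (x * (1 / 2)) * ((x * f x) ^ 2 * d) := by gcongr
        have e3 : 1 / (x * (1 / 2)) * ((x * f x) ^ 2 * d) = 2 * x * f x ^ 2 * d := by
          field_simp
        linarith
      have h2 : x ^ 2 / β * d * f x ≤ P' x := by
        simp only [hP']
        rw [← hd]
        have := h.mul_le hx
        gcongr
      have h3 : 2 * x * f x ^ 2 * d ≤ κ * (x ^ 2 / β * d * f x) * d := by
        have e1 : κ * (x ^ 2 / β * d * f x) * d = Y ^ 3 * x ^ 2 * d * f x * d / (m * X) := by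
          rw [hκ]
          field_simp
        rw [e1, le_div_iff₀ (by positivity)]
        have e2 : (x * f x) ^ 3 ≤ Y ^ 3 := by gcongr
        have e3 : 2 * m * (x * f x ^ 2 * d * X) ≤ x ^ 3 * f x ^ 2 * d * (x * f x ^ 2 * d * x) := by
          gcongr
        have e4 : x ^ 3 * f x ^ 2 * d * (x * f x ^ 2 * d * x)
            = (x * f x) ^ 3 * (x ^ 2 * d * f x * d) := by ring
        have e5 : (x * f x) ^ 3 * (x ^ 2 * d * f x * d) ≤ Y ^ 3 * (x ^ 2 * d * f x * d) := by
          gcongr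
        linarith
      have h4 : κ * (x ^ 2 / β * d * f x) * d ≤ κ * P' x * d := by gcongr
      linarith
  refine ⟨c, hc0, fun x hx => (hlow x hx).trans ?_⟩
  have h1 : exp (κ * P x) ≤ 1 := by
    rw [exp_le_one_iff]
    exact (mul_neg_of_pos_of_neg hκ0 (hPneg x hx)).le
  have h2 : 0 ≤ 1 - A x * C x ^ 2 := by linarith [h.mul_sq_le_one hX hx]
  exact mul_le_of_le_one_right h2 h1

theorem exists_cube_mul_f_le (h : PositiveTail f g A C X) (hX : A X * C X ^ 2 < 1) :
    ∃ K > 0, ∀ x, 2 * X ≤ x → x ^ 3 * f x ≤ K := by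
  obtain ⟨δ, hδ0, hδ⟩ := h.exists_le_one_sub_mul_sq hX
  have hβ0 : 0 < A X * C X := mul_pos (h.A_pos X le_rfl) (h.C_pos X le_rfl)
  set β := A X * C X with hβ
  have hX0 := h.pos
  have hC := h.C_pos X le_rfl
  have hpX : 0 < -(X ^ 2 * g X / C X) := by
    rw [neg_pos]
    exact div_neg_of_neg_of_pos (mul_neg_of_pos_of_neg (by positivity) (h.g_neg hX le_rfl)) hC
  set p := -(X ^ 2 * g X / C X) with hp
  refine ⟨24 / 7 * p * β / δ, by positivity, fun x hx => ?_⟩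
  have hxX : X ≤ x / 2 := by linarith
  have hxX' : X ≤ x := by linarith
  have hx0 := h.pos.trans_le hxX'
  have hf0 := h.f_pos x hxX'
  have h1 := image_le_of_hasDerivAt_nonneg
    (u := fun y => y ^ 2 * g y / C y - δ * f x / (3 * β) * y ^ 3) (show x / 2 ≤ x by linarith)
    (fun s hs => (h.hasDerivAt_flux (hxX.trans hs.1)).sub
      (((hasDerivAt_id s).pow 3).const_mul (δ * f x / (3 * β)))) (fun s hs => by
        have hs1 := hxX.trans hs.1
        have hA := h.A_pos s hs1
        have hC := h.C_pos s hs1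
        have e1 : δ * f x / (3 * β) * (((3 : ℕ) : ℝ) * id s ^ (3 - 1) * 1)
            = s ^ 2 / β * δ * f x := by
          simp; field_simp
        rw [e1, sub_nonneg]
        have := h.mul_le hs1
        have := h.f_anti hX hs1 hs.2
        have := hδ s hs1
        have : 0 ≤ 1 - A s * C s ^ 2 := hδ0.le.trans this
        gcongr)
  have h2 := h.flux_mono hX le_rfl hxX
  have h3 : x ^ 2 * g x / C x ≤ 0 :=
    div_nonpos_of_nonpos_of_nonneg (mul_nonpos_of_nonneg_of_nonpos (by positivity)
      (h.g_neg hX hxX').le) (h.C_pos x hxX').le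
  have h4 : δ * f x / (3 * β) * (7 / 8 * x ^ 3) ≤ p := by
    have : δ * f x / (3 * β) * x ^ 3 - δ * f x / (3 * β) * (x / 2) ^ 3
      = δ * f x / (3 * β) * (7 / 8 * x ^ 3) := by ring
    linarith
  rw [le_div_iff₀ hδ0]
  rw [div_mul_eq_mul_div, div_le_iff₀ (by positivity)] at h4
  linarith

theorem exists_tendsto_mass (h : PositiveTail f g A C X) (hX : A X * C X ^ 2 < 1) :
    ∃ l, Tendsto (massFn A) atTop (𝓝 l) := by
  obtain ⟨K, hK0, hK⟩ := h.exists_cube_mul_f_le hX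
  have hX0 := h.pos
  set p := X ^ 2 * g X / C X with hp
  have ha : 0 < 2 * X + 1 := by linarith
  refine exists_tendsto_of_abs_deriv_le_div_sq (B := p ^ 2 / 2 + K ^ 2) ha
    (fun x hx => h.hasDerivAt_mass (by linarith)) (fun x hx => ?_)
  have hxX : X ≤ x := by linarith
  have hx1 : 1 ≤ x := by linarith
  have hx0 : 0 < x := by linarith
  have hA0 := h.A_pos x hxX
  have hC0 := h.C_pos x hxX
  have hf0 := h.f_pos x hxX
  have hW := h.mul_sq_le_one hX hxX
  rw [abs_of_nonneg (by positivity), le_div_iff₀ (by positivity)]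
  have h1 : (x ^ 2 * g x / C x) ^ 2 ≤ p ^ 2 := by
    have e1 := h.flux_mono hX le_rfl hxX
    have e2 : x ^ 2 * g x / C x ≤ 0 :=
      div_nonpos_of_nonpos_of_nonneg (mul_nonpos_of_nonneg_of_nonpos (by positivity)
        (h.g_neg hX hxX).le) hC0.le
    nlinarith
  have h2 : x ^ 4 * (A x * g x ^ 2) ≤ p ^ 2 := by
    have e : x ^ 4 * (A x * g x ^ 2) = (x ^ 2 * g x / C x) ^ 2 * (A x * C x ^ 2) := by
      field_simp
    rw [e]
    exact (mul_le_of_le_one_right (by positivity) hW).trans h1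
  have h3 : x ^ 4 * f x ^ 2 ≤ K ^ 2 := by
    have e1 : (x ^ 3 * f x) ^ 2 ≤ K ^ 2 := by
      have := hK x (by linarith)
      gcongr
    have e2 : x ^ 4 * f x ^ 2 ≤ x ^ 6 * f x ^ 2 := by
      gcongr
      norm_num
    linarith
  have h4 : x ^ 4 * (A x * C x ^ 2 * f x ^ 2) ≤ x ^ 4 * f x ^ 2 := by
    gcongr
    exact mul_le_of_le_one_left (by positivity) hW
  linarith

theorem asymptotics_of_mul_sq_lt_one (h : PositiveTail f g A C X) (hX : A X * C X ^ 2 < 1) :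
    ∃ Minf Cinf : ℝ,
      0 < Minf ∧ Tendsto (massFn A) atTop (𝓝 Minf) ∧ Tendsto A atTop (𝓝 1) ∧
      0 < Cinf ∧ Cinf < 1 ∧ Tendsto C atTop (𝓝 Cinf) ∧
      Tendsto (fun x => g x / f x) atTop (𝓝 (-√(1 - Cinf ^ 2))) := by
  have hX0 := h.pos
  obtain ⟨M, hM⟩ := h.exists_tendsto_mass hX
  have hM0 : 0 < M := h.mass_pos.trans_le
    (ge_of_tendsto hM ((eventually_ge_atTop X).mono fun x hx => h.mass_mono le_rfl hx))
  have hid : Tendsto (fun x : ℝ => x) atTop atTop := tendsto_id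
  have hA : Tendsto A atTop (𝓝 1) := by
    have h1 : Tendsto (fun x => 1 - 2 * massFn A x / x) atTop (𝓝 (1 - 0)) :=
      tendsto_const_nhds.sub ((hM.const_mul 2).div_atTop hid)
    rw [sub_zero] at h1
    refine h1.congr' ?_
    filter_upwards [eventually_gt_atTop 0] with x hx
    simp only [massFn]
    field_simp
    ring
  obtain ⟨K, hK0, hK⟩ := h.exists_cube_mul_f_le hX
  obtain ⟨δ, hδ0, hδ⟩ := h.exists_le_one_sub_mul_sq hX
  obtain ⟨Z, hZ⟩ := eventually_atTop.1 ((hA.eventually_const_lt one_half_lt_one).and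
    ((hM.eventually_lt_const (lt_add_one M)).and (eventually_ge_atTop (2 * X + 1))))
  have hbound : ∀ x, Z ≤ x → |(A x - 1 + x ^ 2 * f x ^ 2) / (x * A x)|
      ≤ (4 * (M + 1) + 2 * K ^ 2) / x ^ 2 := by
    intro x hx
    obtain ⟨hA2, hM2, hx2⟩ := hZ x hx
    have hx1 : 1 ≤ x := by linarith
    have hx0 : 0 < x := by linarith
    have hxX : X ≤ x := by linarith
    have hA1 := h.A_lt_one hxX
    have hf0 := h.f_pos x hxX
    have h1 : |A x - 1 + x ^ 2 * f x ^ 2| ≤ (2 * (M + 1) + K ^ 2) / x := by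
      rw [le_div_iff₀ hx0]
      have e1 : |A x - 1 + x ^ 2 * f x ^ 2| ≤ (1 - A x) + x ^ 2 * f x ^ 2 := by
        rw [abs_le]
        constructor <;> nlinarith [sq_nonneg (x * f x)]
      have e2 : (1 - A x) * x ≤ 2 * (M + 1) := by
        simp only [massFn] at hM2
        linarith
      have e3 : x ^ 2 * f x ^ 2 * x ≤ K ^ 2 := by
        have e4 : (x ^ 3 * f x) ^ 2 ≤ K ^ 2 := by
          have := hK x (by linarith)
          gcongr
        have e5 : x ^ 3 * f x ^ 2 ≤ x ^ 6 * f x ^ 2 := by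
          gcongr
          norm_num
        linarith
      calc |A x - 1 + x ^ 2 * f x ^ 2| * x ≤ ((1 - A x) + x ^ 2 * f x ^ 2) * x := by gcongr
        _ ≤ _ := by linarith
    rw [abs_div, abs_of_pos (mul_pos hx0 (by linarith : 0 < A x))]
    calc |A x - 1 + x ^ 2 * f x ^ 2| / (x * A x)
        ≤ (2 * (M + 1) + K ^ 2) / x / (x * (1 / 2)) := by gcongr
      _ = _ := by field_simp; ring
  have hZX : ∀ x, Z ≤ x → X ≤ x := fun x hx => by linarith [(hZ x hx).2.2]
  obtain ⟨l, hl⟩ := exists_tendsto_of_abs_deriv_le_div_sq (u := fun x => Real.log (C x))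
    (a := Z) (hX0.trans_le (hZX Z le_rfl)) (fun x hx =>
      ((h.hasDerivAt_C x (hZX x hx)).log (h.C_pos x (hZX x hx)).ne').congr_deriv
        (by have := (h.C_pos x (hZX x hx)).ne'; field_simp)) hbound
  have hC : Tendsto C atTop (𝓝 (exp l)) := by
    refine ((continuous_exp.tendsto l).comp hl).congr' ?_
    filter_upwards [eventually_ge_atTop X] with x hx
    exact exp_log (h.C_pos x hx)
  have hW : Tendsto (fun x => 1 - A x * C x ^ 2) atTop (𝓝 (1 - 1 * exp l ^ 2)) :=
    (hA.mul (hC.pow 2)).const_sub 1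
  have hWδ : δ ≤ 1 - 1 * exp l ^ 2 := ge_of_tendsto hW ((eventually_ge_atTop X).mono hδ)
  rw [one_mul] at hW hWδ
  have hl0 := exp_pos l
  refine ⟨M, exp l, hM0, hM, hA, hl0, by nlinarith, hC, ?_⟩
  have hk : 0 < √(1 - exp l ^ 2) := sqrt_pos.2 (by linarith)
  have he : Tendsto (fun x => -2 / x + (A x - 1 + x ^ 2 * f x ^ 2) / (x * A x)) atTop (𝓝 0) := by
    have h1 : Tendsto (fun x : ℝ => -2 / x) atTop (𝓝 0) := tendsto_const_nhds.div_atTop hid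
    have h2 : Tendsto (fun x : ℝ => (4 * (M + 1) + 2 * K ^ 2) / x ^ 2) atTop (𝓝 0) :=
      tendsto_const_nhds.div_atTop (tendsto_pow_atTop two_ne_zero)
    have h3 := squeeze_zero_norm' (f := fun x => (A x - 1 + x ^ 2 * f x ^ 2) / (x * A x))
      ((eventually_ge_atTop Z).mono hbound) h2
    simpa using h1.add h3
  have hq : Tendsto (fun x => (1 - A x * C x ^ 2) / A x) atTop (𝓝 (√(1 - exp l ^ 2) ^ 2)) := by
    rw [sq_sqrt (by linarith)]
    have := hW.div hA one_ne_zero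
    rwa [div_one] at this
  have := tendsto_of_riccati (u := fun x => -(g x / f x)) (X := X) hk
    (fun x hx => neg_pos.2 (div_neg_of_neg_of_pos (h.g_neg hX hx) (h.f_pos x hx)))
    (fun x hx => div_nonneg (hδ0.le.trans (hδ x hx)) (h.A_pos x hx).le)
    (fun x hx => ((h.hasDerivAt_g x hx).div (h.hasDerivAt_f x hx)
      (h.f_pos x hx).ne').neg.congr_deriv (by
        have := (h.f_pos x hx).ne'
        have := (h.A_pos x hx).ne'
        have := (h.pos.trans_le hx).ne'
        field_simp
        ring)) he hq
  simpa using this.neg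

theorem asymptotics (h : PositiveTail f g A C X) :
    ∃ Minf Cinf : ℝ,
      0 < Minf ∧ Tendsto (massFn A) atTop (𝓝 Minf) ∧ Tendsto A atTop (𝓝 1) ∧
      0 < Cinf ∧ Cinf < 1 ∧ Tendsto C atTop (𝓝 Cinf) ∧
      Tendsto (fun x => g x / f x) atTop (𝓝 (-√(1 - Cinf ^ 2))) := by
  obtain ⟨x, hx, hW⟩ := h.exists_mul_sq_lt_one
  exact (h.mono hx).asymptotics_of_mul_sq_lt_one hW

end PositiveTail

namespace IsRotation

variable {f θ : ℝ → ℝ}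

/-- Where the rotation function equals `π/2 + kπ`, it is strictly increasing. -/
theorem eventually_mul_pos (hθ : IsRotation f θ (Ici 0)) {z : ℝ} (hz : 0 < z)
    (hf : DifferentiableAt ℝ f z) {k : ℤ} (hk : θ z = π / 2 + k * π) :
    ∀ᶠ x in 𝓝[≠] z, 0 < (x - z) * (θ x - θ z) := by
  obtain ⟨ρ, hρ, hfz, hgz⟩ := hθ.2.2 z hz.le
  have hcos : Real.cos (θ z) = 0 := by
    rw [hk, Real.cos_add_int_mul_pi]
    simp
  have hsin : Real.sin (θ z) ≠ 0 := by
    intro h0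
    have := Real.sin_sq_add_cos_sq (θ z)
    rw [h0, hcos] at this
    norm_num at this
  have hslope : ∀ᶠ x in 𝓝[≠] z, 0 < -Real.sin (θ z) * slope f z x := by
    have h1 : Tendsto (fun x => -Real.sin (θ z) * slope f z x) (𝓝[≠] z)
        (𝓝 (-Real.sin (θ z) * deriv f z)) :=
      (hasDerivAt_iff_tendsto_slope.1 hf.hasDerivAt).const_mul _
    refine h1.eventually_const_lt ?_
    rw [hgz]
    have : 0 < Real.sin (θ z) ^ 2 := by positivity
    nlinarith
  have hcont : ContinuousAt θ z := hθ.1.continuousAt (Ici_mem_nhds hz)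
  have hnear : ∀ᶠ x in 𝓝[≠] z, |θ x - θ z| < π / 2 := by
    have := Metric.continuousAt_iff'.1 hcont (π / 2) (by positivity)
    exact (this.filter_mono nhdsWithin_le_nhds)
  filter_upwards [hslope, hnear, self_mem_nhdsWithin,
    nhdsWithin_le_nhds (Ici_mem_nhds hz)] with x hs hn hxz hx0
  obtain ⟨r, hr, hfx, -⟩ := hθ.2.2 x hx0
  have hcx : Real.cos (θ x) = -Real.sin (θ z) * Real.sin (θ x - θ z) := by
    conv_lhs => rw [show θ x = θ z + (θ x - θ z) by ring, Real.cos_add, hcos]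
    ring
  have hxz' : x - z ≠ 0 := sub_ne_zero.2 hxz
  have hsl : slope f z x = r * Real.cos (θ x) / (x - z) := by
    rw [slope_def_field, hfz, hcos, hfx]
    simp
  rw [hsl, hcx] at hs
  have hs2 : 0 < (Real.sin (θ x - θ z)) * (x - z) := by
    have e : -Real.sin (θ z) * (r * (-Real.sin (θ z) * Real.sin (θ x - θ z)) / (x - z))
        = (r * Real.sin (θ z) ^ 2 / (x - z) ^ 2) * (Real.sin (θ x - θ z) * (x - z)) := by
      field_simp
    rw [e] at hs
    exact (mul_pos_iff_of_pos_left (by positivity)).1 hs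
  obtain ⟨hn1, hn2⟩ := abs_lt.1 hn
  rcases lt_trichotomy (θ x - θ z) 0 with h | h | h
  · have : Real.sin (θ x - θ z) < 0 := Real.sin_neg_of_neg_of_neg_pi_lt h (by linarith [pi_pos])
    nlinarith
  · rw [h] at hs2
    simp at hs2
  · have : 0 < Real.sin (θ x - θ z) := Real.sin_pos_of_pos_of_lt_pi h (by linarith [pi_pos])
    nlinarith

/-- Once the rotation function reaches a level `π/2 + kπ`, it stays above it. -/
theorem lt_of_le (hθ : IsRotation f θ (Ici 0)) (hf : ∀ x, 0 < x → DifferentiableAt ℝ f x)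
    {z : ℝ} (hz : 0 < z) {k : ℤ} (hk : π / 2 + k * π ≤ θ z) {x : ℝ} (hx : z < x) :
    π / 2 + k * π < θ x := by
  by_contra! hle
  obtain ⟨w, hzw, hwx, hw⟩ : ∃ w, z ≤ w ∧ w ≤ x ∧ π / 2 + k * π < θ w := by
    rcases hk.lt_or_eq with h | h
    · exact ⟨z, le_rfl, hx.le, h⟩
    · have h1 := (hθ.eventually_mul_pos hz (hf z hz) h.symm).filter_mono
        (nhdsWithin_mono z (fun y (hy : y ∈ Ioi z) => ne_of_gt hy))
      obtain ⟨w, hw, hw2⟩ := (h1.and (Ioo_mem_nhdsGT hx)).exists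
      refine ⟨w, hw2.1.le, hw2.2.le, ?_⟩
      have : 0 < w - z := by linarith [hw2.1]
      rw [h]
      linarith [(mul_pos_iff_of_pos_left this).1 hw]
  have hcont : ContinuousOn θ (Icc w x) :=
    hθ.1.mono fun y hy => (hz.le.trans hzw).trans hy.1
  have hclosed : IsClosed {y ∈ Icc w x | θ y ≤ π / 2 + k * π} :=
    hcont.preimage_isClosed_of_isClosed isClosed_Icc isClosed_Iic
  have hbdd : BddBelow {y ∈ Icc w x | θ y ≤ π / 2 + k * π} := ⟨w, fun y hy => hy.1.1⟩
  have hmem := hclosed.csInf_mem ⟨x, ⟨hwx, le_rfl⟩, hle⟩ hbdd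
  set y := sInf {y ∈ Icc w x | θ y ≤ π / 2 + k * π} with hy
  have hwy : w < y := lt_of_le_of_ne hmem.1.1 (fun h => by
    have := hmem.2
    rw [← h] at this
    linarith)
  have hbefore : ∀ t, w ≤ t → t < y → π / 2 + k * π < θ t := by
    intro t ht hty
    by_contra! h
    exact absurd (csInf_le hbdd ⟨⟨ht, hty.le.trans hmem.1.2⟩, h⟩) (not_le.2 hty)
  have hy0 : 0 < y := by linarith
  have hcy : ContinuousAt θ y := hθ.1.continuousAt (Ici_mem_nhds hy0)
  have hge : π / 2 + k * π ≤ θ y := by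
    refine ge_of_tendsto (hcy.tendsto.mono_left nhdsWithin_le_nhds : Tendsto θ (𝓝[<] y) _) ?_
    filter_upwards [Ioo_mem_nhdsLT hwy] with t ht
    exact (hbefore t ht.1.le ht.2).le
  have heq := le_antisymm hmem.2 hge
  have h1 := (hθ.eventually_mul_pos hy0 (hf y hy0) heq).filter_mono
    (nhdsWithin_mono y (fun t (ht : t ∈ Iio y) => ne_of_lt ht))
  obtain ⟨t, ht, ht2⟩ := (h1.and (Ioo_mem_nhdsLT hwy)).exists
  have := hbefore t ht2.1.le ht2.2
  have h3 : t - y < 0 := by linarith [ht2.2]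
  nlinarith

/-- If the rotation function is bounded above, the field eventually has no zeros. -/
theorem exists_forall_ne_zero_s17 (hθ : IsRotation f θ (Ici 0))
    (hf : ∀ x, 0 < x → DifferentiableAt ℝ f x) {K : ℝ} (hK : ∀ x ∈ Ici (0 : ℝ), θ x ≤ K) :
    ∃ z > 0, ∀ x, z ≤ x → f x ≠ 0 := by
  have hne : ∃ k : ℤ, ∃ z > 0, π / 2 + k * π ≤ θ z := by
    have h1 : π / 2 + ((-⌈(π / 2 - θ 1) / π⌉ : ℤ) : ℝ) * π ≤ θ 1 := by
      have := Int.le_ceil ((π / 2 - θ 1) / π)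
      rw [div_le_iff₀ pi_pos] at this
      push_cast
      linarith
    exact ⟨_, 1, one_pos, h1⟩
  have hbd : ∀ k : ℤ, (∃ z > 0, π / 2 + k * π ≤ θ z) → k ≤ ⌊K / π⌋ := by
    rintro k ⟨z, hz, hk⟩
    rw [Int.le_floor, le_div_iff₀ pi_pos]
    linarith [hK z hz.le, pi_pos]
  obtain ⟨k, ⟨z, hz, hk⟩, hmax⟩ := Int.exists_greatest_of_bdd ⟨_, hbd⟩ hne
  refine ⟨z + 1, by linarith, fun x hx hfx => ?_⟩
  have hx0 : 0 < x := by linarith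
  obtain ⟨ρ, hρ, hfx', -⟩ := hθ.2.2 x hx0.le
  have hcos : Real.cos (θ x) = 0 := by
    rw [hfx] at hfx'
    rcases mul_eq_zero.1 hfx'.symm with h | h
    · exact absurd h hρ.ne'
    · exact h
  obtain ⟨j, hj⟩ := Real.cos_eq_zero_iff.1 hcos
  have h1 := hθ.lt_of_le hf hz hk (show z < x by linarith)
  have h2 : j ≤ k := hmax j ⟨x, hx0, by rw [hj]; linarith⟩
  have h3 : (j : ℝ) ≤ k := by exact_mod_cast h2
  rw [hj] at h1
  nlinarith [pi_pos]

end IsRotation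

namespace MiniBosonSystem

variable {f A C : ℝ → ℝ} {s : Set ℝ}

theorem hasDerivAt_deriv (h : MiniBosonSystem f A C s) {x : ℝ} (hx : x ∈ s) :
    HasDerivAt (deriv f)
      (deriv f x * (-2 / x + (A x - 1 + x ^ 2 * f x ^ 2) / (x * A x))
        + (1 - A x * C x ^ 2) * f x / A x) x := by
  obtain ⟨hx0, hA0, hC0, -, hg, -, hC, hP, -, hC'⟩ := h x hx
  have h1 := ((((hasDerivAt_id x).pow 2).mul hg.hasDerivAt).div hC.hasDerivAt hC0.ne').deriv
  have h2 : deriv (fun y => y ^ 2 * deriv f y / C y) x = _ := h1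
  rw [hP, hC'] at h2
  refine hg.hasDerivAt.congr_deriv ?_
  simp at h2
  field_simp at h2 ⊢
  linarith

theorem neg (h : MiniBosonSystem f A C s) : MiniBosonSystem (fun x => -f x) A C s := by
  intro x hx
  obtain ⟨hx0, hA0, hC0, hf, hg, hA, hC, hP, hA', hC'⟩ := h x hx
  have hd : deriv (fun x => -f x) = fun x => -deriv f x := by
    funext y
    exact deriv.fun_neg
  refine ⟨hx0, hA0, hC0, hf.neg, by rw [hd]; exact hg.neg, hA, hC, ?_, ?_, ?_⟩
  · rw [hd]
    have : (fun y => y ^ 2 * -deriv f y / C y) = fun y => -(y ^ 2 * deriv f y / C y) := by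
      funext y
      ring
    rw [this, deriv.fun_neg, hP]
    ring
  · rw [hd, hA']
    ring
  · rw [hC']
    ring

theorem hasDerivAt_mass_s17 (h : MiniBosonSystem f A C s) {x : ℝ} (hx : x ∈ s) :
    HasDerivAt (massFn A)
      (x ^ 2 / 2 * (A x * deriv f x ^ 2 + A x * C x ^ 2 * f x ^ 2 + f x ^ 2)) x := by
  obtain ⟨hx0, -, -, -, -, hA, -, -, hA', -⟩ := h x hx
  exact hasDerivAt_massFn hx0.ne' (hA.hasDerivAt.congr_deriv hA')

theorem mass_mono (h : MiniBosonSystem f A C (Ici 0 \ {0})) {x y : ℝ} (hx : 0 < x)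
    (hxy : x ≤ y) : massFn A x ≤ massFn A y := by
  have hmem : ∀ z, x ≤ z → z ∈ Ici (0 : ℝ) \ {0} := fun z hz =>
    ⟨(hx.trans_le hz).le, (hx.trans_le hz).ne'⟩
  refine image_le_of_hasDerivAt_nonneg hxy (fun z hz => h.hasDerivAt_mass_s17 (hmem z hz.1))
    (fun z hz => ?_)
  have := (h z (hmem z hz.1)).2.1
  positivity

theorem mass_nonneg (h : MiniBosonSystem f A C (Ici 0 \ {0}))
    (hA : ContinuousWithinAt A (Ici 0) 0) {x : ℝ} (hx : 0 < x) : 0 ≤ massFn A x := by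
  have hc : ContinuousWithinAt (massFn A) (Ici 0) 0 :=
    (continuousWithinAt_id.mul (continuousWithinAt_const.sub hA)).div_const 2
  have h0 : massFn A 0 = 0 := by simp [massFn]
  have ht : Tendsto (massFn A) (𝓝[>] 0) (𝓝 0) := by
    have := hc.tendsto.mono_left (nhdsWithin_mono 0 Ioi_subset_Ici_self)
    rwa [h0] at this
  refine le_of_tendsto ht ?_
  filter_upwards [Ioc_mem_nhdsGT hx] with t ht
  exact h.mass_mono ht.1 ht.2

theorem positiveTail (h : MiniBosonSystem f A C (Ici 0 \ {0}))
    (hA : ContinuousWithinAt A (Ici 0) 0) {z : ℝ} (hz : 0 < z) (hf : ∀ x, z ≤ x → 0 < f x) :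
    PositiveTail f (deriv f) A C (z + 1) := by
  have hmem : ∀ x, z ≤ x → x ∈ Ici (0 : ℝ) \ {0} := fun x hx =>
    ⟨(hz.trans_le hx).le, (hz.trans_le hx).ne'⟩
  have hle : ∀ x, z + 1 ≤ x → z ≤ x := fun x hx => by linarith
  refine ⟨by linarith, fun x hx => (h x (hmem x (hle x hx))).2.1,
    fun x hx => (h x (hmem x (hle x hx))).2.2.1, fun x hx => hf x (hle x hx),
    fun x hx => (h x (hmem x (hle x hx))).2.2.2.1.hasDerivAt,
    fun x hx => h.hasDerivAt_deriv (hmem x (hle x hx)), fun x hx => ?_, fun x hx => ?_, ?_⟩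
  · obtain ⟨-, -, -, -, -, hA, -, -, hA', -⟩ := h x (hmem x (hle x hx))
    exact hA.hasDerivAt.congr_deriv hA'
  · obtain ⟨-, -, -, -, -, -, hC, -, -, hC'⟩ := h x (hmem x (hle x hx))
    exact hC.hasDerivAt.congr_deriv hC'
  · refine (h.mass_nonneg hA hz).trans_lt ?_
    have hmono : StrictMonoOn (massFn A) (Icc z (z + 1)) := by
      refine strictMonoOn_of_deriv_pos (convex_Icc _ _)
        (fun x hx => (h.hasDerivAt_mass_s17 (hmem x hx.1)).continuousAt.continuousWithinAt)
        (fun x hx => ?_)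
      rw [interior_Icc] at hx
      rw [(h.hasDerivAt_mass_s17 (hmem x hx.1.le)).deriv]
      have h1 := (h x (hmem x hx.1.le)).2.1
      have h2 := hf x hx.1.le
      have h3 : 0 < x := hz.trans hx.1
      positivity
    exact hmono (by simp) (by simp) (lt_add_one z)

end MiniBosonSystem

/-- An `a`-orbit defined for all `x ≥ 0` with bounded rotation is
asymptotically flat: the mass function tends to a finite positive limit `M∞`
(so `A → 1`), `C` tends to a limit `C∞ ∈ (0, 1)`, and `f'/f → −√(1 − C∞²)`,
so `f` decays exponentially. -/
theorem asymptotics_of_regular_orbits (f A C θ : ℝ → ℝ) (a α : ℝ)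
    (ha : 0 < a) (hα : 1 < α)
    (horbit : IsAOrbit f A C a α (Set.Ici 0))
    (hnv : ∀ x ∈ Set.Ici (0 : ℝ), (f x, deriv f x) ≠ (0, 0))
    (hθ : IsRotation f θ (Set.Ici 0))
    (hbd : ∃ K : ℝ, ∀ x ∈ Set.Ici (0 : ℝ), θ x ≤ K) :
    ∃ Minf Cinf : ℝ,
      0 < Minf ∧ Filter.Tendsto (massFn A) Filter.atTop (nhds Minf) ∧
      Filter.Tendsto A Filter.atTop (nhds 1) ∧
      0 < Cinf ∧ Cinf < 1 ∧ Filter.Tendsto C Filter.atTop (nhds Cinf) ∧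
      Filter.Tendsto (fun x => deriv f x / f x) Filter.atTop
        (nhds (-Real.sqrt (1 - Cinf ^ 2))) := by
  obtain ⟨-, hsys, -, hA, -⟩ := horbit
  obtain ⟨K, hK⟩ := hbd
  have hdiff : ∀ x, 0 < x → DifferentiableAt ℝ f x := fun x hx =>
    (hsys x ⟨hx.le, hx.ne'⟩).2.2.2.1
  obtain ⟨z, hz, hne⟩ := hθ.exists_forall_ne_zero_s17 hdiff hK
  have hcont : ContinuousOn f (Ici z) := fun x hx =>
    (hdiff x (hz.trans_le hx)).continuousAt.continuousWithinAt
  have hsign : (∀ x, z ≤ x → 0 < f x) ∨ ∀ x, z ≤ x → f x < 0 := by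
    rcases (hne z le_rfl).lt_or_gt with h0 | h0
    · refine Or.inr fun x hx => ?_
      by_contra! h
      obtain ⟨y, hy, hy0⟩ := intermediate_value_Icc hx (hcont.mono Icc_subset_Ici_self) ⟨h0.le, h⟩
      exact hne y hy.1 hy0
    · refine Or.inl fun x hx => ?_
      by_contra! h
      obtain ⟨y, hy, hy0⟩ := intermediate_value_Icc' hx (hcont.mono Icc_subset_Ici_self) ⟨h, h0.le⟩
      exact hne y hy.1 hy0
  rcases hsign with hpos | hneg
  · exact (hsys.positiveTail hA hz hpos).asymptotics
  · have := (hsys.neg.positiveTail hA hz fun x hx => neg_pos.2 (hneg x hx)).asymptotics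
    simpa only [deriv.fun_neg, neg_div_neg_eq] using this
end
end
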